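/- Let e_K = Σ_{β∈K} e_β, where e_β ∈ g_β are nonzero root vectors. 1° Suppose the highest root θ is a fundamental weight, and let α̃ be the unique simple root with (θ, α̃) ≠ 0. Then (i) (ad e_K)^4(e_{−θ+α̃}) ≠ 0, and (ii) (ad e_K)^5 = 0; in particular the height of e_K is 4. 2° If θ is not a fundamental weight (i.e., g is of type A_n, n ≥ 2, or C_n), then (ad e_K)^3 = 0, so the height of e_K is 2. -/

import Mathlib

open scoped RealInnerProductSpace

attribute [local instance] Classical.propDecidable

section RootCombinatorics

variable {V : Type*} [NormedAddCommGroup V] [InnerProductSpace ℝ V]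

/-- The Cartan pairing `⟨γ, α∨⟩ = 2 (γ, α) / (α, α)`. -/
noncomputable def cartanPairing (γ α : V) : ℝ := 2 * ⟪γ, α⟫ / ⟪α, α⟫

/-- The coroot `γ∨ = 2 γ / (γ, γ)`. -/
noncomputable def covec (γ : V) : V := (2 / ⟪γ, γ⟫) • γ

/-- The cascade element `x_K = Σ_{β ∈ K} β / (β, β) = ½ Σ_{β ∈ K} β∨`. -/
noncomputable def cascElt (K : Finset V) : V := ∑ β ∈ K, (⟪β, β⟫)⁻¹ • β

/-- The roots of `S` orthogonal to `β`. -/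
noncomputable def orthSub (S : Finset V) (β : V) : Finset V := S.filter fun γ => ⟪γ, β⟫ = 0

/-- One step of the non-orthogonality (connectedness) relation inside `S`. -/
def connRel (S : Finset V) (a b : V) : Prop := a ∈ S ∧ b ∈ S ∧ ⟪a, b⟫ ≠ 0

/-- The irreducible component of the root subsystem `S` containing `γ`. -/
noncomputable def component (S : Finset V) (γ : V) : Finset V :=
  S.filter fun γ' => Relation.ReflTransGen (connRel S) γ γ'

/-- `C` is an irreducible component of the root subsystem `S`. -/
def IsComponent (S C : Finset V) : Prop := ∃ γ ∈ S, C = component S γ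

end RootCombinatorics

/-- The combinatorial data of an irreducible crystallographic root system with a chosen
system of positive roots, base (set of simple roots) and highest root: the combinatorial
skeleton of a finite-dimensional complex simple Lie algebra, with the Killing-form
identification of the Cartan subalgebra and its dual. -/
structure RootSystemCtx (V : Type*) [NormedAddCommGroup V] [InnerProductSpace ℝ V] where
  /-- the set of roots Δ -/
  Δ : Finset V
  /-- the set of simple roots Π -/
  base : Finset V
  /-- the set of positive roots Δ⁺ -/
  Pos : Finset V
  /-- the highest root θ -/
  θ : V
  zero_not_mem : (0 : V) ∉ Δ
  neg_mem : ∀ γ ∈ Δ, -γ ∈ Δ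
  reflect_mem : ∀ α ∈ Δ, ∀ γ ∈ Δ, γ - cartanPairing γ α • α ∈ Δ
  pairing_int : ∀ α ∈ Δ, ∀ γ ∈ Δ, ∃ k : ℤ, cartanPairing γ α = (k : ℝ)
  span_eq : Submodule.span ℝ (Δ : Set V) = ⊤
  base_subset : base ⊆ Pos
  base_indep : LinearIndependent ℝ (fun a : {x // x ∈ base} => (a : V))
  pos_subset : Pos ⊆ Δ
  pos_or_neg : ∀ γ ∈ Δ, γ ∈ Pos ∨ -γ ∈ Pos
  pos_not_neg : ∀ γ ∈ Pos, -γ ∉ Pos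
  pos_coords : ∀ γ ∈ Pos, γ ∈ AddSubmonoid.closure (base : Set V)
  irreducible : ∀ S : Finset V, S ⊆ Δ → S.Nonempty →
    (∀ a ∈ S, ∀ b ∈ Δ, b ∉ S → ⟪a, b⟫ = 0) → S = Δ
  theta_mem : θ ∈ Pos
  theta_highest : ∀ γ ∈ Δ, θ - γ ∈ AddSubmonoid.closure (base : Set V)

namespace RootSystemCtx

variable {V : Type*} [NormedAddCommGroup V] [InnerProductSpace ℝ V]

variable (ctx : RootSystemCtx V)

/-- The root order `γ ≼ γ'` on roots: `γ' - γ` is a nonnegative integral combination of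
simple roots. -/
def rootLE (γ γ' : V) : Prop := γ' - γ ∈ AddSubmonoid.closure (ctx.base : Set V)

/-- `β` is the highest root of the root subsystem `S` (with respect to the ambient positive
system). -/
def IsHighest (S : Finset V) (β : V) : Prop :=
  β ∈ S ∧ β ∈ ctx.Pos ∧ ∀ γ ∈ S, ctx.rootLE γ β

/-- `CascadeMem ctx S β` : the pair (root subsystem `S = Δ⟨i⟩`, its highest root `β = βᵢ`)
occurs in the recursive construction of the Kostant cascade: one starts with `(Δ, θ)`, and the
descendants of `(S, β)` are the pairs `(C, β')` where `C` is an irreducible component of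
`{γ ∈ S | (γ, β) = 0}` and `β'` is the highest root of `C`. -/
inductive CascadeMem : Finset V → V → Prop
  | top : CascadeMem ctx.Δ ctx.θ
  | step {S C : Finset V} {β β' : V} : CascadeMem S β →
      IsComponent (orthSub S β) C → ctx.IsHighest C β' → CascadeMem C β'

/-- `K` is the Kostant cascade of the root system. -/
def IsCascade (K : Finset V) : Prop := ∀ β, β ∈ K ↔ ∃ S, ctx.CascadeMem S β

/-- The Heisenberg subset `H_β = {γ ∈ S ∩ Δ⁺ : (γ, β) > 0}` attached to a cascade pair
`(S, β)`. -/
noncomputable def heis (S : Finset V) (β : V) : Finset V :=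
  S.filter fun γ => γ ∈ ctx.Pos ∧ 0 < ⟪γ, β⟫

/-- A root is long if it has the same length as the highest root. -/
def IsLong (γ : V) : Prop := ⟪γ, γ⟫ = ⟪ctx.θ, ctx.θ⟫

/-- The highest root `θ` is a fundamental weight. -/
def ThetaFundamental : Prop :=
  ∃ α ∈ ctx.base, cartanPairing ctx.θ α = 1 ∧
    ∀ β ∈ ctx.base, β ≠ α → cartanPairing ctx.θ β = 0

/-- `β'` is a descendant of the cascade element `β`. -/
def Desc (β β' : V) : Prop :=
  ∃ S C, ctx.CascadeMem S β ∧ IsComponent (orthSub S β) C ∧ ctx.IsHighest C β'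

/-- The cascade poset order: `β ≤ β'` iff `β` is an iterated descendant of `β'`. -/
def cascLE (β β' : V) : Prop := Relation.ReflTransGen (fun a b => ctx.Desc b a) β β'

/-- A simple reflection of the root system. -/
def IsSimpleReflection (w : V ≃ₗ[ℝ] V) : Prop :=
  ∃ α ∈ ctx.base, ∀ v, w v = v - (2 * ⟪v, α⟫ / ⟪α, α⟫) • α

/-- The Weyl group, generated by the simple reflections. -/
def weylGroup : Subgroup (V ≃ₗ[ℝ] V) := Subgroup.closure {w | ctx.IsSimpleReflection w}

/-- The length of a Weyl group element: the minimal number of simple reflections needed to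
express it. -/
noncomputable def length (w : V ≃ₗ[ℝ] V) : ℕ :=
  sInf {n | ∃ l : List (V ≃ₗ[ℝ] V), l.length = n ∧
    (∀ s ∈ l, ctx.IsSimpleReflection s) ∧ l.prod = w}

/-- The root system is of type `Aₙ` (Cartan matrix characterisation). -/
def IsTypeA (n : ℕ) : Prop :=
  1 ≤ n ∧ ∃ e : Fin n ≃ {x // x ∈ ctx.base}, ∀ i j : Fin n,
    cartanPairing (e i : V) (e j : V) =
      (if i = j then 2 else if i.val + 1 = j.val ∨ j.val + 1 = i.val then -1 else 0)

/-- The root system is of type `Bₙ` (`n ≥ 2`), with the last simple root short. -/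
def IsTypeB (n : ℕ) : Prop :=
  2 ≤ n ∧ ∃ e : Fin n ≃ {x // x ∈ ctx.base}, ∀ i j : Fin n,
    cartanPairing (e i : V) (e j : V) =
      (if i = j then 2
       else if i.val + 2 = n ∧ j.val + 1 = n then -2
       else if i.val + 1 = j.val ∨ j.val + 1 = i.val then -1 else 0)

/-- The root system is of type `Cₙ` (`n ≥ 2`), with the last simple root long. -/
def IsTypeC (n : ℕ) : Prop :=
  2 ≤ n ∧ ∃ e : Fin n ≃ {x // x ∈ ctx.base}, ∀ i j : Fin n,
    cartanPairing (e i : V) (e j : V) =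
      (if i = j then 2
       else if i.val + 1 = n ∧ j.val + 2 = n then -2
       else if i.val + 1 = j.val ∨ j.val + 1 = i.val then -1 else 0)

/-- The root system is of type `G₂` (first simple root short). -/
def IsTypeG2 : Prop :=
  ∃ e : Fin 2 ≃ {x // x ∈ ctx.base},
    cartanPairing (e 0 : V) (e 0 : V) = 2 ∧ cartanPairing (e 1 : V) (e 1 : V) = 2 ∧
    cartanPairing (e 0 : V) (e 1 : V) = -1 ∧ cartanPairing (e 1 : V) (e 0 : V) = -3

/-- The set of roots `Δ(a_z) = w(Δ⁺_z(-1)) ∪ w(-Δ⁺_z(2))` of the abelian ideal attached by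
Kostant's construction to `z` (with `w = w_z`). -/
def idealSet (w : V ≃ₗ[ℝ] V) (x : V) : Set V :=
  {δ | ∃ γ ∈ ctx.Pos, (⟪γ, x⟫ = -1 ∧ δ = w γ) ∨ (⟪γ, x⟫ = 2 ∧ δ = -(w γ))}

end RootSystemCtx

/-- A root-space decomposition of a finite-dimensional complex Lie algebra `g` compatible
with the root-system data `ctx`: a Cartan subalgebra `t`, root vectors `e γ` for `γ ∈ Δ`,
and the Killing identification `coh : V → t` of the rational/real form of the Cartan
subalgebra with the Euclidean space `V` carrying the root system. -/
structure LieRootData {V : Type*} [NormedAddCommGroup V] [InnerProductSpace ℝ V]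
    (ctx : RootSystemCtx V) (g : Type*) [LieRing g] [LieAlgebra ℂ g] where
  t : LieSubalgebra ℂ g
  e : V → g
  coh : V → g
  coh_add : ∀ v w, coh (v + w) = coh v + coh w
  coh_smul : ∀ (r : ℝ) (v : V), coh (r • v) = (r : ℂ) • coh v
  coh_inj : ∀ v, coh v = 0 → v = 0
  coh_mem : ∀ v, coh v ∈ t
  t_span : t.toSubmodule = Submodule.span ℂ (Set.range coh)
  t_abelian : ∀ x ∈ t, ∀ y ∈ t, ⁅x, y⁆ = (0 : g)
  e_ne : ∀ γ ∈ ctx.Δ, e γ ≠ 0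
  bracket_coh_e : ∀ (v : V), ∀ γ ∈ ctx.Δ, ⁅coh v, e γ⁆ = (⟪γ, v⟫ : ℂ) • e γ
  bracket_e_e_root : ∀ γ ∈ ctx.Δ, ∀ δ ∈ ctx.Δ, γ + δ ∈ ctx.Δ →
    ∃ c : ℂ, c ≠ 0 ∧ ⁅e γ, e δ⁆ = c • e (γ + δ)
  bracket_e_e_neg : ∀ γ ∈ ctx.Δ, ∃ c : ℂ, c ≠ 0 ∧ ⁅e γ, e (-γ)⁆ = c • coh γ
  bracket_e_e_zero : ∀ γ ∈ ctx.Δ, ∀ δ ∈ ctx.Δ, γ + δ ∉ ctx.Δ → γ + δ ≠ 0 → ⁅e γ, e δ⁆ = 0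
  span_top : (⊤ : Submodule ℂ g) = t.toSubmodule ⊔ Submodule.span ℂ (e '' (ctx.Δ : Set V))
  dim_eq : Module.finrank ℂ g = Module.finrank ℂ ↥t + ctx.Δ.card
  rank_eq : Module.finrank ℂ ↥t = ctx.base.card

section CartanPairing

variable {V : Type*} [NormedAddCommGroup V] [InnerProductSpace ℝ V]

theorem two_mul_inner (v w : V) : 2 * ⟪v, w⟫ = cartanPairing v w * ⟪w, w⟫ := by
  unfold cartanPairing
  by_cases hw : w = 0
  · simp [hw]
  · have : ⟪w, w⟫ ≠ 0 := inner_self_ne_zero.mpr hw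
    field_simp

theorem cartanPairing_add (v v' w : V) :
    cartanPairing (v + v') w = cartanPairing v w + cartanPairing v' w := by
  simp only [cartanPairing, inner_add_left]; ring

theorem cartanPairing_neg (v w : V) : cartanPairing (-v) w = -cartanPairing v w := by
  simp only [cartanPairing, inner_neg_left]; ring

theorem cartanPairing_sub (v v' w : V) :
    cartanPairing (v - v') w = cartanPairing v w - cartanPairing v' w := by
  rw [sub_eq_add_neg, cartanPairing_add, cartanPairing_neg, sub_eq_add_neg]

theorem cartanPairing_smul (r : ℝ) (v w : V) :
    cartanPairing (r • v) w = r * cartanPairing v w := by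
  simp only [cartanPairing, real_inner_smul_left]; ring

theorem cartanPairing_self {w : V} (hw : w ≠ 0) : cartanPairing w w = 2 := by
  have : ⟪w, w⟫ ≠ 0 := inner_self_ne_zero.mpr hw
  unfold cartanPairing
  field_simp

theorem cartanPairing_eq_zero_iff {v w : V} (hw : w ≠ 0) :
    cartanPairing v w = 0 ↔ ⟪v, w⟫ = 0 := by
  simp [cartanPairing, hw]

theorem cartanPairing_pos_iff {v w : V} (hw : w ≠ 0) :
    0 < cartanPairing v w ↔ 0 < ⟪v, w⟫ := by
  have h : 0 < ⟪w, w⟫ := real_inner_self_pos.mpr hw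
  have h2 := two_mul_inner v w
  constructor
  · intro h3
    nlinarith [mul_pos h3 h]
  · intro h3
    by_contra! h4
    nlinarith [mul_nonneg (neg_nonneg.mpr h4) h.le]

theorem cartanPairing_nonneg_iff {v w : V} (hw : w ≠ 0) :
    0 ≤ cartanPairing v w ↔ 0 ≤ ⟪v, w⟫ := by
  rw [le_iff_lt_or_eq, le_iff_lt_or_eq, cartanPairing_pos_iff hw, eq_comm (a := (0 : ℝ)),
    eq_comm (a := (0 : ℝ)), cartanPairing_eq_zero_iff hw]

/-- The weight of `v` with respect to the sum of the coroots of the elements of `Q`. -/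
noncomputable def corootWeight (Q : Finset V) (v : V) : ℝ := ∑ β ∈ Q, cartanPairing v β

/-- The sum `∑ ⟨v, β∨⟩ β` over `Q`; for orthogonal `Q` it is twice the orthogonal projection
of `v` to the span of `Q`. -/
noncomputable def twiceProj (Q : Finset V) (v : V) : V := ∑ β ∈ Q, cartanPairing v β • β

theorem corootWeight_add (Q : Finset V) (v w : V) :
    corootWeight Q (v + w) = corootWeight Q v + corootWeight Q w := by
  simp [corootWeight, cartanPairing_add, Finset.sum_add_distrib]

theorem corootWeight_neg (Q : Finset V) (v : V) : corootWeight Q (-v) = -corootWeight Q v := by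
  simp [corootWeight, cartanPairing_neg]

theorem corootWeight_sub (Q : Finset V) (v w : V) :
    corootWeight Q (v - w) = corootWeight Q v - corootWeight Q w := by
  rw [sub_eq_add_neg, corootWeight_add, corootWeight_neg, sub_eq_add_neg]

theorem corootWeight_zero (Q : Finset V) : corootWeight Q 0 = 0 := by
  simp [corootWeight, cartanPairing]

theorem twiceProj_add (Q : Finset V) (v w : V) :
    twiceProj Q (v + w) = twiceProj Q v + twiceProj Q w := by
  simp [twiceProj, cartanPairing_add, Finset.sum_add_distrib, add_smul]

theorem inner_twiceProj_of_orthogonal {Q : Finset V} {w : V} (v : V)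
    (hw : ∀ β ∈ Q, ⟪β, w⟫ = 0) : ⟪twiceProj Q v, w⟫ = 0 := by
  rw [twiceProj, sum_inner]
  exact Finset.sum_eq_zero fun β hβ => by rw [real_inner_smul_left, hw β hβ, mul_zero]

theorem inner_twiceProj_of_mem {Q : Finset V} (hQ : (Q : Set V).Pairwise fun a b => ⟪a, b⟫ = 0)
    {β : V} (hβ : β ∈ Q) (v : V) : ⟪twiceProj Q v, β⟫ = 2 * ⟪v, β⟫ := by
  rw [twiceProj, sum_inner, Finset.sum_eq_single_of_mem β hβ, real_inner_smul_left,
    ← two_mul_inner]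
  intro b hb hne
  rw [real_inner_smul_left, hQ hb hβ hne, mul_zero]

theorem two_mul_inner_twiceProj (Q : Finset V) (v : V) :
    2 * ⟪twiceProj Q v, v⟫ =
      (∑ β ∈ Q, cartanPairing v β * cartanPairing β v) * ⟪v, v⟫ := by
  rw [twiceProj, sum_inner, Finset.mul_sum, Finset.sum_mul]
  refine Finset.sum_congr rfl fun β _ => ?_
  rw [real_inner_smul_left]
  linear_combination cartanPairing v β * two_mul_inner β v

theorem inner_twiceProj_self {Q : Finset V}
    (hQ : (Q : Set V).Pairwise fun a b => ⟪a, b⟫ = 0) (v : V) :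
    ⟪twiceProj Q v, twiceProj Q v⟫ = 2 * ⟪twiceProj Q v, v⟫ := by
  conv_lhs => rw [twiceProj, sum_inner]
  conv_rhs => rw [twiceProj, sum_inner, Finset.mul_sum]
  refine Finset.sum_congr rfl fun β hβ => ?_
  have h := inner_twiceProj_of_mem hQ hβ v
  rw [twiceProj] at h
  rw [real_inner_smul_left, real_inner_smul_left, real_inner_comm, h, real_inner_comm v β]
  ring

/-- The defect in Bessel's inequality for an orthogonal family. -/
theorem inner_two_smul_sub_twiceProj {Q : Finset V}
    (hQ : (Q : Set V).Pairwise fun a b => ⟪a, b⟫ = 0) (v : V) :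
    ⟪(2 : ℝ) • v - twiceProj Q v, (2 : ℝ) • v - twiceProj Q v⟫ =
      (4 - ∑ β ∈ Q, cartanPairing v β * cartanPairing β v) * ⟪v, v⟫ := by
  have h1 := inner_twiceProj_self hQ v
  have h2 := two_mul_inner_twiceProj Q v
  simp only [inner_sub_left, inner_sub_right, real_inner_smul_left, real_inner_smul_right]
  rw [real_inner_comm (twiceProj Q v) v]
  linear_combination h1 - h2

theorem sum_cartanPairing_mul_le_four {Q : Finset V}
    (hQ : (Q : Set V).Pairwise fun a b => ⟪a, b⟫ = 0) {v : V} (hv : v ≠ 0) :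
    ∑ β ∈ Q, cartanPairing v β * cartanPairing β v ≤ 4 := by
  have h1 := inner_two_smul_sub_twiceProj hQ v
  have h2 : 0 ≤ ⟪(2 : ℝ) • v - twiceProj Q v, (2 : ℝ) • v - twiceProj Q v⟫ :=
    real_inner_self_nonneg
  have h3 : 0 < ⟪v, v⟫ := real_inner_self_pos.mpr hv
  rw [h1] at h2
  linarith [nonneg_of_mul_nonneg_left h2 h3]

theorem two_smul_eq_twiceProj {Q : Finset V}
    (hQ : (Q : Set V).Pairwise fun a b => ⟪a, b⟫ = 0) {v : V}
    (h : ∑ β ∈ Q, cartanPairing v β * cartanPairing β v = 4) :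
    (2 : ℝ) • v = twiceProj Q v := by
  have h1 := inner_two_smul_sub_twiceProj hQ v
  rw [h, sub_self, zero_mul, inner_self_eq_zero, sub_eq_zero] at h1
  exact h1

/-- A set stable under the reflections in the members of an orthogonal family that are not
orthogonal to `v ∈ U` is stable, at `v`, under their product. -/
theorem sub_twiceProj_mem {U Q : Finset V}
    (hQ : (Q : Set V).Pairwise fun a b => ⟪a, b⟫ = 0) {v : V} (hv : v ∈ U)
    (h : ∀ β ∈ Q, cartanPairing v β ≠ 0 → ∀ u ∈ U, u - cartanPairing u β • β ∈ U) :
    v - twiceProj Q v ∈ U := by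
  induction Q using Finset.induction_on with
  | empty => simpa [twiceProj] using hv
  | insert β Q hβ ih =>
    have hQ' : (Q : Set V).Pairwise fun a b => ⟪a, b⟫ = 0 :=
      hQ.mono (by simp)
    have hu := ih hQ' fun b hb => h b (Finset.mem_insert_of_mem hb)
    have horth : ∀ b ∈ Q, ⟪b, β⟫ = 0 := fun b hb =>
      hQ (by simp [hb]) (by simp) (fun e => hβ (e ▸ hb))
    have hp : cartanPairing (v - twiceProj Q v) β = cartanPairing v β := by
      rw [cartanPairing_sub, sub_eq_self, cartanPairing, inner_twiceProj_of_orthogonal v horth]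
      simp
    have hs : v - twiceProj (insert β Q) v =
        (v - twiceProj Q v) - cartanPairing v β • β := by
      rw [twiceProj, Finset.sum_insert hβ, twiceProj]
      abel
    rw [hs]
    by_cases h0 : cartanPairing v β = 0
    · simpa [h0] using hu
    · have := h β (Finset.mem_insert_self _ _) h0 _ hu
      rwa [hp] at this

end CartanPairing

namespace RootSystemCtx

variable {V : Type*} [NormedAddCommGroup V] [InnerProductSpace ℝ V] (ctx : RootSystemCtx V)

/-- The nonnegative integral combinations of simple roots. -/
abbrev cone : AddSubmonoid V := AddSubmonoid.closure (ctx.base : Set V)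

variable {ctx}

theorem ne_zero_of_mem {γ : V} (hγ : γ ∈ ctx.Δ) : γ ≠ 0 := fun h => ctx.zero_not_mem (h ▸ hγ)

theorem inner_self_pos_of_mem {γ : V} (hγ : γ ∈ ctx.Δ) : 0 < ⟪γ, γ⟫ :=
  real_inner_self_pos.mpr (ne_zero_of_mem hγ)

theorem theta_mem_root : ctx.θ ∈ ctx.Δ := ctx.pos_subset ctx.theta_mem

theorem base_mem_root {α : V} (hα : α ∈ ctx.base) : α ∈ ctx.Δ :=
  ctx.pos_subset (ctx.base_subset hα)

variable (ctx) in
theorem exists_linearMap_base (c : V → ℝ) : ∃ f : V →ₗ[ℝ] ℝ, ∀ a ∈ ctx.base, f a = c a := by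
  obtain ⟨f, hf⟩ := LinearMap.exists_extend
    ((Module.Basis.span ctx.base_indep).constr ℝ fun a => c a)
  refine ⟨f, fun a ha => ?_⟩
  have h := (Module.Basis.span ctx.base_indep).constr_basis ℝ (fun a => c a) ⟨a, ha⟩
  rw [← hf] at h
  rw [LinearMap.comp_apply, Submodule.subtype_apply, Module.Basis.span_apply] at h
  exact h

variable (ctx) in
theorem exists_height : ∃ f : V →ₗ[ℝ] ℝ, ∀ m ∈ ctx.cone, m = 0 ∨ 0 < f m := by
  obtain ⟨f, hf⟩ := ctx.exists_linearMap_base fun _ => 1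
  refine ⟨f, fun m hm => ?_⟩
  induction hm using AddSubmonoid.closure_induction with
  | mem x hx => right; rw [hf x hx]; exact one_pos
  | zero => left; rfl
  | add x y _ _ hx hy =>
    rcases hx with rfl | hx
    · simpa using hy
    · rcases hy with rfl | hy
      · simpa using Or.inr hx
      · right; rw [map_add]; positivity

theorem eq_zero_of_mem_cone_of_neg_mem_cone {m : V} (h : m ∈ ctx.cone) (h' : -m ∈ ctx.cone) :
    m = 0 := by
  obtain ⟨f, hf⟩ := ctx.exists_height
  rcases hf m h with h0 | h0
  · exact h0
  · rcases hf _ h' with h1 | h1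
    · exact neg_eq_zero.mp h1
    · rw [map_neg] at h1; linarith

theorem eq_zero_of_add_eq_zero {m m' : V} (h : m ∈ ctx.cone) (h' : m' ∈ ctx.cone)
    (hadd : m + m' = 0) : m = 0 :=
  eq_zero_of_mem_cone_of_neg_mem_cone h (by rwa [neg_eq_of_add_eq_zero_right hadd])

theorem mem_cone_of_pos {γ : V} (hγ : γ ∈ ctx.Pos) : γ ∈ ctx.cone := ctx.pos_coords γ hγ

theorem neg_pos_of_not_pos {γ : V} (hγ : γ ∈ ctx.Δ) (h : γ ∉ ctx.Pos) : -γ ∈ ctx.Pos :=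
  (ctx.pos_or_neg γ hγ).resolve_left h

theorem pos_of_mem_cone {γ : V} (hγ : γ ∈ ctx.Δ) (h : γ ∈ ctx.cone) : γ ∈ ctx.Pos := by
  by_contra hn
  exact ne_zero_of_mem hγ
    (eq_zero_of_mem_cone_of_neg_mem_cone h (mem_cone_of_pos (neg_pos_of_not_pos hγ hn)))

theorem neg_not_mem_cone_of_pos {γ : V} (hγ : γ ∈ ctx.Pos) : -γ ∉ ctx.cone := fun h =>
  ctx.pos_not_neg γ hγ (pos_of_mem_cone (ctx.neg_mem γ (ctx.pos_subset hγ)) h)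

theorem one_le_cartanPairing {γ α : V} (hγ : γ ∈ ctx.Δ) (hα : α ∈ ctx.Δ) (h : 0 < ⟪γ, α⟫) :
    1 ≤ cartanPairing γ α := by
  have h1 := (cartanPairing_pos_iff (ne_zero_of_mem hα)).mpr h
  obtain ⟨k, hk⟩ := ctx.pairing_int α hα γ hγ
  rw [hk] at h1 ⊢
  exact_mod_cast h1

theorem sub_mem_or_eq {a b : V} (ha : a ∈ ctx.Δ) (hb : b ∈ ctx.Δ) (h : 0 < ⟪a, b⟫) :
    a - b ∈ ctx.Δ ∨ a = b := by
  have hba : 0 < ⟪b, a⟫ := by rwa [real_inner_comm]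
  by_cases h1 : cartanPairing a b = 1
  · left
    have := ctx.reflect_mem b hb a ha
    rwa [h1, one_smul] at this
  by_cases h2 : cartanPairing b a = 1
  · left
    have := ctx.neg_mem _ (ctx.reflect_mem a ha b hb)
    rwa [h2, one_smul, neg_sub] at this
  right
  have h3 : 2 ≤ cartanPairing a b := by
    have := one_le_cartanPairing ha hb h
    obtain ⟨k, hk⟩ := ctx.pairing_int b hb a ha
    rw [hk] at this h1 ⊢
    have h' : 1 ≤ k := by exact_mod_cast this
    have h'' : k ≠ 1 := by exact_mod_cast h1
    exact_mod_cast (by omega : 2 ≤ k)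
  have h4 : 2 ≤ cartanPairing b a := by
    have := one_le_cartanPairing hb ha hba
    obtain ⟨k, hk⟩ := ctx.pairing_int a ha b hb
    rw [hk] at this h2 ⊢
    have h' : 1 ≤ k := by exact_mod_cast this
    have h'' : k ≠ 1 := by exact_mod_cast h2
    exact_mod_cast (by omega : 2 ≤ k)
  have h5 := two_mul_inner a b
  have h6 := two_mul_inner b a
  rw [real_inner_comm] at h6
  have h7 := inner_self_pos_of_mem ha
  have h8 := inner_self_pos_of_mem hb
  rw [← sub_eq_zero, ← inner_self_eq_zero (𝕜 := ℝ)]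
  refine le_antisymm ?_ real_inner_self_nonneg
  rw [inner_sub_left, inner_sub_right, inner_sub_right, real_inner_comm a b]
  nlinarith

theorem add_mem_or_eq_neg {a b : V} (ha : a ∈ ctx.Δ) (hb : b ∈ ctx.Δ) (h : ⟪a, b⟫ < 0) :
    a + b ∈ ctx.Δ ∨ a = -b := by
  have := sub_mem_or_eq ha (ctx.neg_mem b hb) (by rw [inner_neg_right]; linarith)
  rwa [sub_neg_eq_add] at this

variable (ctx) in
/-- A closed root subsystem of `Δ`. -/
structure IsClosedSubsystem (S : Finset V) : Prop where
  subset : S ⊆ ctx.Δ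
  neg_mem : ∀ a ∈ S, -a ∈ S
  add_mem : ∀ a ∈ S, ∀ b ∈ S, a + b ∈ ctx.Δ → a + b ∈ S
  reflect_mem : ∀ b ∈ S, ∀ a ∈ S, a - cartanPairing a b • b ∈ S

theorem IsClosedSubsystem.sub_mem {S : Finset V} (hS : ctx.IsClosedSubsystem S) {a b : V}
    (ha : a ∈ S) (hb : b ∈ S) (h : a - b ∈ ctx.Δ) : a - b ∈ S := by
  rw [sub_eq_add_neg] at h ⊢
  exact hS.add_mem a ha _ (hS.neg_mem b hb) h

theorem isClosedSubsystem_root : ctx.IsClosedSubsystem ctx.Δ :=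
  ⟨subset_rfl, ctx.neg_mem, fun _ _ _ _ h => h, ctx.reflect_mem⟩

theorem mem_orthSub {S : Finset V} {β γ : V} : γ ∈ orthSub S β ↔ γ ∈ S ∧ ⟪γ, β⟫ = 0 := by
  simp [orthSub]

theorem IsClosedSubsystem.orthSub {S : Finset V} (hS : ctx.IsClosedSubsystem S) (β : V) :
    ctx.IsClosedSubsystem (orthSub S β) where
  subset := fun a ha => hS.subset (mem_orthSub.mp ha).1
  neg_mem := fun a ha => by
    rw [mem_orthSub] at ha ⊢
    exact ⟨hS.neg_mem a ha.1, by rw [inner_neg_left, ha.2, neg_zero]⟩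
  add_mem := fun a ha b hb h => by
    rw [mem_orthSub] at ha hb ⊢
    exact ⟨hS.add_mem a ha.1 b hb.1 h, by rw [inner_add_left, ha.2, hb.2, add_zero]⟩
  reflect_mem := fun b hb a ha => by
    rw [mem_orthSub] at ha hb ⊢
    exact ⟨hS.reflect_mem b hb.1 a ha.1, by
      rw [inner_sub_left, real_inner_smul_left, ha.2, hb.2, mul_zero, sub_zero]⟩

/-- Any two elements of `S` have a common non-orthogonal neighbour in `S`. -/
def IsLinked (S : Finset V) : Prop := ∀ a ∈ S, ∀ b ∈ S, ∃ ε ∈ S, ⟪a, ε⟫ ≠ 0 ∧ ⟪ε, b⟫ ≠ 0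

/-- An irreducible component, described by its closure property and its linkedness. -/
structure IsBlock (T C : Finset V) : Prop where
  subset : C ⊆ T
  nonempty : C.Nonempty
  mem_of_inner_ne_zero : ∀ a ∈ C, ∀ b ∈ T, ⟪a, b⟫ ≠ 0 → b ∈ C
  linked : IsLinked C

theorem exists_link_of_reflTransGen {T : Finset V} (hT : ctx.IsClosedSubsystem T) {a b : V}
    (ha : a ∈ T) (h : Relation.ReflTransGen (connRel T) a b) :
    ∃ ε ∈ T, ⟪a, ε⟫ ≠ 0 ∧ ⟪ε, b⟫ ≠ 0 := by
  have hne {c : V} (hc : c ∈ T) : ⟪c, c⟫ ≠ 0 := (inner_self_pos_of_mem (hT.subset hc)).ne'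
  induction h with
  | refl => exact ⟨a, ha, hne ha, hne ha⟩
  | @tail b c _ hbc ih =>
    obtain ⟨ε, hε, hae, heb⟩ := ih
    obtain ⟨hb, hc, hbc⟩ := hbc
    by_cases h1 : ⟪ε, c⟫ = 0
    swap
    · exact ⟨ε, hε, hae, h1⟩
    by_cases h2 : ⟪a, b⟫ = 0
    swap
    · exact ⟨b, hb, h2, hbc⟩
    rcases lt_or_gt_of_ne heb with h3 | h3
    · rcases add_mem_or_eq_neg (hT.subset hε) (hT.subset hb) h3 with h4 | h4
      · exact ⟨ε + b, hT.add_mem ε hε b hb h4, by simpa [inner_add_right, h2] using hae,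
          by simpa [inner_add_left, h1] using hbc⟩
      · rw [h4, inner_neg_right, h2] at hae
        simp at hae
    · rcases sub_mem_or_eq (hT.subset hε) (hT.subset hb) h3 with h4 | h4
      · exact ⟨ε - b, hT.sub_mem hε hb h4, by simpa [inner_sub_right, h2] using hae,
          by simpa [inner_sub_left, h1] using hbc⟩
      · rw [h4, h2] at hae
        simp at hae

theorem mem_component {T : Finset V} {γ δ : V} :
    δ ∈ component T γ ↔ δ ∈ T ∧ Relation.ReflTransGen (connRel T) γ δ := by
  simp [component]

theorem isBlock_component {T : Finset V} (hT : ctx.IsClosedSubsystem T) {γ : V} (hγ : γ ∈ T) :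
    IsBlock T (component T γ) where
  subset := fun a ha => (mem_component.mp ha).1
  nonempty := ⟨γ, mem_component.mpr ⟨hγ, Relation.ReflTransGen.refl⟩⟩
  mem_of_inner_ne_zero := fun a ha b hb h => by
    rw [mem_component] at ha ⊢
    exact ⟨hb, ha.2.tail ⟨ha.1, hb, h⟩⟩
  linked := fun a ha b hb => by
    rw [mem_component] at ha hb
    have hsymm : Std.Symm (connRel T) :=
      ⟨fun x y h => ⟨h.2.1, h.1, by rw [real_inner_comm]; exact h.2.2⟩⟩
    have hab : Relation.ReflTransGen (connRel T) a b :=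
      (Std.Symm.symm (r := Relation.ReflTransGen (connRel T)) _ _ ha.2).trans hb.2
    obtain ⟨ε, hε, h1, h2⟩ := exists_link_of_reflTransGen hT ha.1 hab
    exact ⟨ε, mem_component.mpr ⟨hε, ha.2.tail ⟨ha.1, hε, h1⟩⟩, h1, h2⟩

theorem IsBlock.subset_of_linked {T C U : Finset V} (hC : IsBlock T C) (hU : IsLinked U)
    (hUT : U ⊆ T) {a : V} (haU : a ∈ U) (haC : a ∈ C) : U ⊆ C := fun b hb => by
  obtain ⟨ε, hε, h1, h2⟩ := hU a haU b hb
  exact hC.mem_of_inner_ne_zero ε (hC.mem_of_inner_ne_zero a haC ε (hUT hε) h1) b (hUT hb) h2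

theorem IsBlock.eq_of_mem {T C C' : Finset V} (hC : IsBlock T C) (hC' : IsBlock T C') {a : V}
    (ha : a ∈ C) (ha' : a ∈ C') : C = C' :=
  (hC'.subset_of_linked hC.linked hC.subset ha ha').antisymm
    (hC.subset_of_linked hC'.linked hC'.subset ha' ha)

theorem IsBlock.isClosedSubsystem {T C : Finset V} (hC : IsBlock T C)
    (hT : ctx.IsClosedSubsystem T) : ctx.IsClosedSubsystem C where
  subset := hC.subset.trans hT.subset
  neg_mem := fun a ha => by
    have haT := hC.subset ha
    refine hC.mem_of_inner_ne_zero a ha _ (hT.neg_mem a haT) ?_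
    rw [inner_neg_right, neg_ne_zero]
    exact (inner_self_pos_of_mem (hT.subset haT)).ne'
  add_mem := fun a ha b hb h => by
    have h1 := hT.add_mem a (hC.subset ha) b (hC.subset hb) h
    by_cases h2 : ⟪a, a + b⟫ = 0
    · refine hC.mem_of_inner_ne_zero b hb _ h1 fun h3 => ?_
      have h4 := inner_self_pos_of_mem h
      rw [inner_add_left, h2, h3, add_zero] at h4
      exact h4.false
    · exact hC.mem_of_inner_ne_zero a ha _ h1 h2
  reflect_mem := fun b hb a ha => by
    have h1 := hT.reflect_mem b (hC.subset hb) a (hC.subset ha)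
    by_cases h2 : cartanPairing a b = 0
    · simpa [h2] using ha
    · refine hC.mem_of_inner_ne_zero b hb _ h1 ?_
      have hb0 := ne_zero_of_mem (hT.subset (hC.subset hb))
      have h3 := two_mul_inner a b
      rw [real_inner_comm, inner_sub_left, real_inner_smul_left, ← h3]
      intro h4
      exact h2 ((cartanPairing_eq_zero_iff hb0).mpr (by linarith))

theorem isLinked_root : IsLinked ctx.Δ := by
  have hB := isBlock_component (isClosedSubsystem_root (ctx := ctx)) theta_mem_root
  have : component ctx.Δ ctx.θ = ctx.Δ := by
    refine ctx.irreducible _ hB.subset hB.nonempty fun a ha b hb h => ?_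
    by_contra h1
    exact h (hB.mem_of_inner_ne_zero a ha b hb h1)
  exact this ▸ hB.linked

theorem IsHighest.inner_nonneg {S : Finset V} (hS : ctx.IsClosedSubsystem S) {β γ : V}
    (hβ : ctx.IsHighest S β) (hγ : γ ∈ S) (hpos : γ ∈ ctx.Pos) : 0 ≤ ⟪γ, β⟫ := by
  obtain ⟨h1, h2, h3⟩ := hβ
  by_contra! h
  rcases add_mem_or_eq_neg (hS.subset hγ) (hS.subset h1) h with h4 | h4
  · have h5 := h3 _ (hS.add_mem γ hγ β h1 h4)
    rw [rootLE, sub_add_cancel_right] at h5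
    exact neg_not_mem_cone_of_pos hpos h5
  · exact ctx.pos_not_neg β h2 (h4 ▸ hpos)

theorem IsHighest.unique {S : Finset V} {β β' : V} (h : ctx.IsHighest S β)
    (h' : ctx.IsHighest S β') : β = β' := by
  have h1 := h.2.2 β' h'.1
  have h2 := h'.2.2 β h.1
  rw [rootLE] at h1 h2
  rw [← sub_eq_zero]
  exact eq_zero_of_mem_cone_of_neg_mem_cone h1 (by rwa [neg_sub])

theorem exists_isHighest {C : Finset V} (hC : ctx.IsClosedSubsystem C) (hlink : IsLinked C)
    (hne : C.Nonempty) : ∃ β, ctx.IsHighest C β := by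
  obtain ⟨f, hf⟩ := ctx.exists_height
  have hmono {x y : V} (hy : y - x ∈ ctx.cone) (hle : f y ≤ f x) : y = x := by
    rcases hf _ hy with h | h
    · exact sub_eq_zero.mp h
    · rw [map_sub] at h; linarith
  have hmax (x : V) (hx : x ∈ C) : ∃ y ∈ C, y - x ∈ ctx.cone ∧
      ∀ δ ∈ C, δ - y ∈ ctx.cone → δ = y := by
    obtain ⟨y, hy, hym⟩ := (C.filter fun y => y - x ∈ ctx.cone).exists_max_image f
      ⟨x, by simp [hx]⟩
    rw [Finset.mem_filter] at hy
    refine ⟨y, hy.1, hy.2, fun δ hδ h => hmono h (hym δ ?_)⟩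
    rw [Finset.mem_filter]
    refine ⟨hδ, ?_⟩
    have := add_mem h hy.2
    rwa [sub_add_sub_cancel] at this
  have hdom {y δ : V} (hy : y ∈ C) (hym : ∀ δ ∈ C, δ - y ∈ ctx.cone → δ = y) (hδ : δ ∈ C)
      (hpos : δ ∈ ctx.Pos) : 0 ≤ ⟪y, δ⟫ := by
    by_contra! h
    have hδ0 := ne_zero_of_mem (hC.subset hδ)
    rcases add_mem_or_eq_neg (hC.subset hy) (hC.subset hδ) h with h1 | h1
    · have := hym _ (hC.add_mem y hy δ hδ h1)
        (by rw [add_sub_cancel_left]; exact mem_cone_of_pos hpos)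
      exact hδ0 (by simpa using this)
    · have := hym δ hδ (by
        rw [h1, sub_neg_eq_add]
        exact add_mem (mem_cone_of_pos hpos) (mem_cone_of_pos hpos))
      rw [h1, eq_neg_iff_add_eq_zero, ← two_smul ℝ δ] at this
      simp [hδ0] at this
  have hYpos {y : V} (hy : y ∈ C) (hym : ∀ δ ∈ C, δ - y ∈ ctx.cone → δ = y) :
      y ∈ ctx.Pos := by
    by_contra hn
    have h1 := hdom hy hym (hC.neg_mem y hy) (neg_pos_of_not_pos (hC.subset hy) hn)
    rw [inner_neg_right] at h1
    linarith [inner_self_pos_of_mem (hC.subset hy)]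
  -- removing a non-orthogonal positive root from a maximal root gives a positive root
  have hsub {y δ : V} (hy : y ∈ C) (hym : ∀ δ ∈ C, δ - y ∈ ctx.cone → δ = y) (hδ : δ ∈ C)
      (h : 0 < ⟪y, δ⟫) : y = δ ∨ (y - δ ∈ C ∧ y - δ ∈ ctx.Pos) := by
    rcases sub_mem_or_eq (hC.subset hy) (hC.subset hδ) h with h1 | h1
    · right
      refine ⟨hC.sub_mem hy hδ h1, ?_⟩
      by_contra hn
      have h2 := mem_cone_of_pos (neg_pos_of_not_pos h1 hn)
      rw [neg_sub] at h2
      have := hym δ hδ h2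
      rw [this, sub_self] at h1
      exact ctx.zero_not_mem h1
    · exact Or.inl h1
  have huniq {y z : V} (hy : y ∈ C) (hym : ∀ δ ∈ C, δ - y ∈ ctx.cone → δ = y)
      (hz : z ∈ C) (hzm : ∀ δ ∈ C, δ - z ∈ ctx.cone → δ = z) : y = z := by
    have h0 := hdom hy hym hz (hYpos hz hzm)
    rcases h0.lt_or_eq with h1 | h1
    · rcases hsub hy hym hz h1 with h2 | ⟨_, h2⟩
      · exact h2
      · exact hzm y hy (mem_cone_of_pos h2)
    · exfalso
      obtain ⟨ε, hε, h2, h3⟩ := hlink y hy z hz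
      wlog hεpos : ε ∈ ctx.Pos generalizing ε
      · exact this (-ε) (hC.neg_mem ε hε) (by simpa [inner_neg_right] using h2)
          (by simpa [inner_neg_left] using h3) (neg_pos_of_not_pos (hC.subset hε) hεpos)
      have h4 : 0 < ⟪y, ε⟫ := lt_of_le_of_ne (hdom hy hym hε hεpos) (Ne.symm h2)
      have h5 : 0 < ⟪z, ε⟫ := lt_of_le_of_ne (hdom hz hzm hε hεpos)
        (by rw [real_inner_comm]; exact Ne.symm h3)
      rcases hsub hy hym hε h4 with h6 | ⟨h6, h7⟩
      · rw [← h6, real_inner_comm] at h5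
        linarith
      · have := hdom hz hzm h6 h7
        rw [inner_sub_right, real_inner_comm, ← h1] at this
        linarith
  obtain ⟨x, hx⟩ := hne
  obtain ⟨y, hy, -, hym⟩ := hmax x hx
  refine ⟨y, hy, hYpos hy hym, fun γ hγ => ?_⟩
  obtain ⟨z, hz, hzγ, hzm⟩ := hmax γ hγ
  rw [huniq hy hym hz hzm]
  exact hzγ

theorem CascadeMem.isClosedSubsystem_isLinked_isHighest {S : Finset V} {β : V}
    (h : ctx.CascadeMem S β) :
    ctx.IsClosedSubsystem S ∧ IsLinked S ∧ ctx.IsHighest S β := by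
  induction h with
  | top => exact ⟨isClosedSubsystem_root, isLinked_root, theta_mem_root, ctx.theta_mem,
      ctx.theta_highest⟩
  | step _ hC hβ ih =>
    obtain ⟨γ, hγ, rfl⟩ := hC
    have hB := isBlock_component (ih.1.orthSub _) hγ
    exact ⟨hB.isClosedSubsystem (ih.1.orthSub _), hB.linked, hβ⟩

theorem CascadeMem.isClosedSubsystem {S : Finset V} {β : V} (h : ctx.CascadeMem S β) :
    ctx.IsClosedSubsystem S := h.isClosedSubsystem_isLinked_isHighest.1

theorem CascadeMem.isLinked {S : Finset V} {β : V} (h : ctx.CascadeMem S β) :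
    IsLinked S := h.isClosedSubsystem_isLinked_isHighest.2.1

theorem CascadeMem.isHighest {S : Finset V} {β : V} (h : ctx.CascadeMem S β) :
    ctx.IsHighest S β := h.isClosedSubsystem_isLinked_isHighest.2.2

theorem CascadeMem.mem {S : Finset V} {β : V} (h : ctx.CascadeMem S β) : β ∈ S := h.isHighest.1

theorem CascadeMem.pos {S : Finset V} {β : V} (h : ctx.CascadeMem S β) : β ∈ ctx.Pos :=
  h.isHighest.2.1

theorem orthSub_subset (S : Finset V) (β : V) : orthSub S β ⊆ S := Finset.filter_subset _ _

theorem CascadeMem.not_mem_orthSub {S T : Finset V} {β : V} (h : ctx.CascadeMem S β) :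
    β ∉ orthSub T β := fun h' =>
  (inner_self_pos_of_mem (h.isClosedSubsystem.subset h.mem)).ne' (mem_orthSub.mp h').2

/-- Every positive root of `S` is non-orthogonal to some cascade element whose subsystem
contains it. -/
theorem CascadeMem.exists_inner_ne_zero {S : Finset V} {β γ : V} (h : ctx.CascadeMem S β)
    (hγ : γ ∈ S) : ∃ S' β', ctx.CascadeMem S' β' ∧ γ ∈ S' ∧ ⟪γ, β'⟫ ≠ 0 := by
  induction hn : S.card using Nat.strong_induction_on generalizing S β with
  | _ n ih =>
    by_cases h0 : ⟪γ, β⟫ = 0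
    swap
    · exact ⟨S, β, h, hγ, h0⟩
    have hO := h.isClosedSubsystem.orthSub β
    have hγO : γ ∈ orthSub S β := mem_orthSub.mpr ⟨hγ, h0⟩
    have hB := isBlock_component hO hγO
    obtain ⟨β', hβ'⟩ := exists_isHighest (hB.isClosedSubsystem hO) hB.linked hB.nonempty
    refine ih _ ?_ (h.step ⟨γ, hγO, rfl⟩ hβ')
      (mem_component.mpr ⟨hγO, Relation.ReflTransGen.refl⟩) rfl
    rw [← hn]
    refine Finset.card_lt_card (Finset.ssubset_of_subset_of_ssubset hB.subset ?_)
    exact (Finset.ssubset_iff_of_subset (orthSub_subset S β)).mpr ⟨β, h.mem, h.not_mem_orthSub⟩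

variable (ctx) in
/-- The possible relative positions of two cascade pairs: equal, one below the other, or
orthogonal with no root sums. -/
inductive RelPos (S : Finset V) (β : V) (S' : Finset V) (β' : V) : Prop
  | eq (hS : S' = S) (hβ : β' = β)
  | below (h : S' ⊆ orthSub S β)
  | above (h : S ⊆ orthSub S' β')
  | apart (h : ∀ a ∈ S, ∀ b ∈ S', ⟪a, b⟫ = 0 ∧ a + b ∉ ctx.Δ)

theorem IsBlock.inner_eq_zero_and_add_notMem {T C C' : Finset V} (hT : ctx.IsClosedSubsystem T)
    (hC : IsBlock T C) (hC' : IsBlock T C') (hne : C ≠ C') :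
    ∀ a ∈ C, ∀ b ∈ C', ⟪a, b⟫ = 0 ∧ a + b ∉ ctx.Δ := fun a ha b hb => by
  have h0 : ⟪a, b⟫ = 0 := by
    by_contra h
    exact hne (hC.eq_of_mem hC' (hC.mem_of_inner_ne_zero a ha b (hC'.subset hb) h) hb)
  refine ⟨h0, fun h => hne (hC.eq_of_mem hC' (a := a + b) ?_ ?_)⟩
  all_goals have hT' := hT.add_mem a (hC.subset ha) b (hC'.subset hb) h
  · refine hC.mem_of_inner_ne_zero a ha _ hT' ?_
    rw [inner_add_right, h0, add_zero]
    exact (inner_self_pos_of_mem (hT.subset (hC.subset ha))).ne'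
  · refine hC'.mem_of_inner_ne_zero b hb _ hT' ?_
    rw [inner_add_right, real_inner_comm, h0, zero_add]
    exact (inner_self_pos_of_mem (hT.subset (hC'.subset hb))).ne'

theorem CascadeMem.top_relPos {S : Finset V} {β : V} (h : ctx.CascadeMem S β) :
    ctx.RelPos ctx.Δ ctx.θ S β := by
  induction h with
  | top => exact .eq rfl rfl
  | @step S C β β' h hC hβ ih =>
    obtain ⟨γ, hγ, rfl⟩ := hC
    have hCO := (isBlock_component (h.isClosedSubsystem.orthSub β) hγ).subset
    have hCS := hCO.trans (orthSub_subset _ _)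
    cases ih with
    | eq hS hb => subst hS hb; exact .below hCO
    | below hb => exact .below (hCS.trans hb)
    | above ha =>
      exact absurd (ha (h.isClosedSubsystem.subset h.mem)) h.not_mem_orthSub
    | apart ha =>
      have := (ha β (h.isClosedSubsystem.subset h.mem) β h.mem).1
      exact absurd this (inner_self_pos_of_mem (h.isClosedSubsystem.subset h.mem)).ne'

theorem RelPos.symm {S S' : Finset V} {β β' : V} (h : ctx.RelPos S β S' β') :
    ctx.RelPos S' β' S β := by
  cases h with
  | eq hS hβ => exact .eq hS.symm hβ.symm
  | below h => exact .above h
  | above h => exact .below h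
  | apart h =>
    refine .apart fun a ha b hb => ?_
    rw [real_inner_comm, add_comm]
    exact h b hb a ha

theorem CascadeMem.relPos {S S' : Finset V} {β β' : V} (h : ctx.CascadeMem S β)
    (h' : ctx.CascadeMem S' β') : ctx.RelPos S β S' β' := by
  induction h generalizing S' β' with
  | top => exact h'.top_relPos
  | @step S C β β₁ h hC hβ ih =>
    have hC₁ := h.step hC hβ
    obtain ⟨γ, hγ, rfl⟩ := hC
    have hO := h.isClosedSubsystem.orthSub β
    have hB := isBlock_component hO hγ
    have hCS := hB.subset.trans (orthSub_subset _ _)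
    generalize component (orthSub S β) γ = C at *
    induction h' with
    | top => exact hC₁.top_relPos.symm
    | @step S₂ C' β₂ β₁' h₂ hC' hβ' ih₂ =>
      have hC₁' := h₂.step hC' hβ'
      obtain ⟨γ', hγ', rfl⟩ := hC'
      have hO' := h₂.isClosedSubsystem.orthSub β₂
      have hB' := isBlock_component hO' hγ'
      have hCS' := hB'.subset.trans (orthSub_subset _ _)
      generalize component (orthSub S₂ β₂) γ' = C' at *
      cases ih₂ with
      | eq hS hb => subst hS hb; exact .below hB'.subset
      | below hb => exact .below (hCS'.trans hb)
      | apart ha => exact .apart fun a haC b hb => ha a haC b (hCS' hb)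
      | above ha =>
        cases ih h₂ with
        | eq hS hb =>
          subst hS hb
          by_cases hCC : C = C'
          · subst hCC
            exact .eq rfl (hβ'.unique hβ)
          · exact .apart (hB.inner_eq_zero_and_add_notMem hO hB' hCC)
        | below hb =>
          have := hB.subset_of_linked h₂.isLinked hb
            (orthSub_subset _ _ (ha hC₁.mem)) hC₁.mem
          exact absurd (ha (this h₂.mem)) h₂.not_mem_orthSub
        | apart hap =>
          have h1 := (hap β₁ (hCS hC₁.mem) β₁ (orthSub_subset _ _ (ha hC₁.mem))).1
          exact absurd h1
            (inner_self_pos_of_mem (hC₁.isClosedSubsystem.subset hC₁.mem)).ne'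
        | above hab =>
          cases ih hC₁' with
          | eq hS hb => exact .above (hS ▸ hb ▸ hB.subset)
          | above h => exact .above (hCS.trans h)
          | apart h => exact .apart fun a haC b hb => h a (hCS haC) b hb
          | below hbl =>
            have := hB'.subset_of_linked h.isLinked hab
              (orthSub_subset _ _ (hbl hC₁'.mem)) hC₁'.mem
            exact absurd (hbl (this h.mem)) h.not_mem_orthSub

section Cascade

variable {K : Finset V}

theorem IsCascade.pos_of_mem (hK : ctx.IsCascade K) {β : V} (hβ : β ∈ K) : β ∈ ctx.Pos := by
  obtain ⟨S, h⟩ := (hK β).mp hβ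
  exact h.pos

theorem IsCascade.mem_root (hK : ctx.IsCascade K) {β : V} (hβ : β ∈ K) : β ∈ ctx.Δ :=
  ctx.pos_subset (hK.pos_of_mem hβ)

theorem IsCascade.theta_mem (hK : ctx.IsCascade K) : ctx.θ ∈ K :=
  (hK _).mpr ⟨_, CascadeMem.top⟩

/-- Distinct members of the cascade are strongly orthogonal. -/
theorem IsCascade.inner_eq_zero_and_add_notMem (hK : ctx.IsCascade K) {β β' : V} (hβ : β ∈ K)
    (hβ' : β' ∈ K) (hne : β ≠ β') : ⟪β, β'⟫ = 0 ∧ β + β' ∉ ctx.Δ := by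
  have key {S S' : Finset V} {β β' : V} (h : ctx.CascadeMem S β) (h' : ctx.CascadeMem S' β')
      (hb : S' ⊆ orthSub S β) : ⟪β', β⟫ = 0 ∧ β' + β ∉ ctx.Δ := by
    have h1 := mem_orthSub.mp (hb h'.mem)
    refine ⟨h1.2, fun h2 => ?_⟩
    have h3 := h.isHighest.2.2 _ (h.isClosedSubsystem.add_mem _ h1.1 _ h.mem h2)
    rw [rootLE, sub_add_cancel_right] at h3
    exact neg_not_mem_cone_of_pos h'.pos h3
  obtain ⟨S, h⟩ := (hK β).mp hβ
  obtain ⟨S', h'⟩ := (hK β').mp hβ'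
  cases h.relPos h' with
  | eq _ h => exact absurd h.symm hne
  | below hb => rw [real_inner_comm, add_comm]; exact key h h' hb
  | above ha => exact key h' h ha
  | apart ha => exact ha β h.mem β' h'.mem

theorem IsCascade.pairwise (hK : ctx.IsCascade K) :
    (K : Set V).Pairwise fun a b => ⟪a, b⟫ = 0 := fun _ ha _ hb hne =>
  (hK.inner_eq_zero_and_add_notMem ha hb hne).1

theorem IsCascade.sub_notMem (hK : ctx.IsCascade K) {β β' : V} (hβ : β ∈ K)
    (hβ' : β' ∈ K) (hne : β ≠ β') : β - β' ∉ ctx.Δ := fun h => by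
  obtain ⟨h1, h2⟩ := hK.inner_eq_zero_and_add_notMem hβ hβ' hne
  have h3 := ctx.reflect_mem β' (hK.mem_root hβ') _ h
  have hβ'0 := ne_zero_of_mem (hK.mem_root hβ')
  rw [cartanPairing_sub, cartanPairing_self hβ'0, (cartanPairing_eq_zero_iff hβ'0).mpr h1] at h3
  apply h2
  convert h3 using 1
  module

/-- The product of the reflections in the cascade sends positive roots to negative roots. -/
theorem IsCascade.neg_reflect_pos (hK : ctx.IsCascade K) {γ : V} (hγ : γ ∈ ctx.Pos) :
    twiceProj K γ - γ ∈ ctx.Pos := by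
  obtain ⟨S, β, h, hγS, hne⟩ :=
    (CascadeMem.top (ctx := ctx)).exists_inner_ne_zero (ctx.pos_subset hγ)
  have hβK : β ∈ K := (hK β).mpr ⟨S, h⟩
  have hS := h.isClosedSubsystem
  have hmem : γ - twiceProj K γ ∈ S := by
    refine sub_twiceProj_mem hK.pairwise hγS fun β' hβ' hn => ?_
    obtain ⟨S', h'⟩ := (hK β').mp hβ'
    rw [Ne, cartanPairing_eq_zero_iff (ne_zero_of_mem (hK.mem_root hβ'))] at hn
    have hβS : β' ∈ S := by
      cases h.relPos h' with
      | eq hS hb => exact hb ▸ h.mem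
      | below hb => exact orthSub_subset _ _ (hb h'.mem)
      | above ha => exact absurd (mem_orthSub.mp (ha hγS)).2 hn
      | apart ha => exact absurd (ha γ hγS β' h'.mem).1 hn
    exact hS.reflect_mem β' hβS
  have hpos : 0 < ⟪γ, β⟫ := lt_of_le_of_ne (h.isHighest.inner_nonneg hS hγS hγ) (Ne.symm hne)
  have hn : γ - twiceProj K γ ∉ ctx.Pos := fun hp => by
    have h1 := h.isHighest.inner_nonneg hS hmem hp
    rw [inner_sub_left, inner_twiceProj_of_mem hK.pairwise hβK] at h1
    linarith
  have := neg_pos_of_not_pos (hS.subset hmem) hn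
  rwa [neg_sub] at this

theorem exists_int_corootWeight {Q : Finset V} (hQ : Q ⊆ ctx.Δ) {γ : V} (hγ : γ ∈ ctx.Δ) :
    ∃ k : ℤ, corootWeight Q γ = k := by
  choose! k hk using fun β (hβ : β ∈ Q) => ctx.pairing_int β (hQ hβ) γ hγ
  exact ⟨∑ β ∈ Q, k β, by rw [corootWeight, Finset.sum_congr rfl hk]; push_cast; rfl⟩

theorem cartanPairing_le_mul {β γ : V} (hβ : β ∈ ctx.Δ) (hγ : γ ∈ ctx.Δ) :
    cartanPairing γ β ≤ cartanPairing γ β * cartanPairing β γ := by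
  rcases lt_or_ge 0 ⟪γ, β⟫ with h | h
  · have h1 := one_le_cartanPairing hγ hβ h
    have h2 := one_le_cartanPairing hβ hγ (by rwa [real_inner_comm])
    nlinarith
  · have h1 : cartanPairing γ β ≤ 0 := by
      by_contra! h2
      exact h.not_gt ((cartanPairing_pos_iff (ne_zero_of_mem hβ)).mp h2)
    have h1' : cartanPairing β γ ≤ 0 := by
      by_contra! h2
      rw [cartanPairing_pos_iff (ne_zero_of_mem hγ), real_inner_comm] at h2
      exact h.not_gt h2
    exact h1.trans (mul_nonneg_of_nonpos_of_nonpos h1 h1')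

theorem corootWeight_le_sum {Q : Finset V} (hQ : Q ⊆ ctx.Δ) {γ : V} (hγ : γ ∈ ctx.Δ) :
    corootWeight Q γ ≤ ∑ β ∈ Q, cartanPairing γ β * cartanPairing β γ :=
  Finset.sum_le_sum fun _ hβ => cartanPairing_le_mul (hQ hβ) hγ

theorem IsCascade.subset_root (hK : ctx.IsCascade K) : K ⊆ ctx.Δ := fun _ h => hK.mem_root h

theorem IsCascade.corootWeight_le_four (hK : ctx.IsCascade K) {γ : V} (hγ : γ ∈ ctx.Δ) :
    corootWeight K γ ≤ 4 :=
  (corootWeight_le_sum hK.subset_root hγ).trans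
    (sum_cartanPairing_mul_le_four hK.pairwise (ne_zero_of_mem hγ))

theorem IsCascade.corootWeight_of_mem (hK : ctx.IsCascade K) {β : V} (hβ : β ∈ K) :
    corootWeight K β = 2 := by
  rw [corootWeight, Finset.sum_eq_single_of_mem β hβ,
    cartanPairing_self (ne_zero_of_mem (hK.mem_root hβ))]
  intro b hb hne
  rw [cartanPairing_eq_zero_iff (ne_zero_of_mem (hK.mem_root hb))]
  exact hK.pairwise hβ hb hne.symm

theorem IsCascade.erase_subset_root (hK : ctx.IsCascade K) : K.erase ctx.θ ⊆ ctx.Δ :=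
  (Finset.erase_subset _ _).trans hK.subset_root

theorem IsCascade.pairwise_erase (hK : ctx.IsCascade K) :
    ((K.erase ctx.θ : Finset V) : Set V).Pairwise fun a b => ⟪a, b⟫ = 0 :=
  hK.pairwise.mono (by simp)

theorem IsCascade.inner_theta_of_mem_erase (hK : ctx.IsCascade K) {β : V}
    (hβ : β ∈ K.erase ctx.θ) : ⟪β, ctx.θ⟫ = 0 :=
  hK.pairwise (Finset.mem_of_mem_erase hβ) hK.theta_mem (Finset.ne_of_mem_erase hβ)

theorem IsCascade.corootWeight_eq (hK : ctx.IsCascade K) (γ : V) :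
    corootWeight K γ = cartanPairing γ ctx.θ + corootWeight (K.erase ctx.θ) γ :=
  (Finset.add_sum_erase K _ hK.theta_mem).symm

theorem IsCascade.corootWeight_erase_theta (hK : ctx.IsCascade K) :
    corootWeight (K.erase ctx.θ) ctx.θ = 0 := by
  have h1 := hK.corootWeight_eq ctx.θ
  rw [hK.corootWeight_of_mem hK.theta_mem,
    cartanPairing_self (ne_zero_of_mem theta_mem_root)] at h1
  linarith

theorem inner_theta_nonneg_of_pos {γ : V} (hγ : γ ∈ ctx.Pos) : 0 ≤ ⟪γ, ctx.θ⟫ :=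
  (CascadeMem.top (ctx := ctx)).isHighest.inner_nonneg isClosedSubsystem_root
    (ctx.pos_subset hγ) hγ

theorem inner_theta_nonneg {m : V} (hm : m ∈ ctx.cone) : 0 ≤ ⟪m, ctx.θ⟫ := by
  induction hm using AddSubmonoid.closure_induction with
  | mem x hx => exact inner_theta_nonneg_of_pos (ctx.base_subset hx)
  | zero => simp
  | add x y _ _ hx hy => rw [inner_add_left]; exact add_nonneg hx hy

theorem theta_ne_zero : ctx.θ ≠ 0 := ne_zero_of_mem theta_mem_root

theorem eq_theta_of_two_le {δ : V} (hδ : δ ∈ ctx.Δ) (h : 2 ≤ cartanPairing δ ctx.θ) :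
    δ = ctx.θ := by
  have h0 := two_mul_inner δ ctx.θ
  have h1 := inner_self_pos_of_mem (theta_mem_root (ctx := ctx))
  have h2 : 0 < ⟪ctx.θ, δ⟫ := by rw [real_inner_comm]; nlinarith
  rcases sub_mem_or_eq theta_mem_root hδ h2 with h3 | h3
  swap
  · exact h3.symm
  exfalso
  have hc := ctx.theta_highest δ hδ
  have h4 := inner_theta_nonneg hc
  have h5 : ⟪ctx.θ - δ, ctx.θ⟫ = 0 := by
    refine le_antisymm ?_ h4
    rw [inner_sub_left]
    nlinarith
  have h6 := ctx.reflect_mem _ h3 δ hδ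
  have h7 : cartanPairing δ (ctx.θ - δ) = -2 := by
    have h8 : cartanPairing (ctx.θ - (ctx.θ - δ)) (ctx.θ - δ) = -2 := by
      rw [cartanPairing_sub, cartanPairing_self (ne_zero_of_mem h3),
        (cartanPairing_eq_zero_iff (ne_zero_of_mem h3)).mpr (by rwa [real_inner_comm])]
      ring
    rwa [sub_sub_cancel] at h8
  have h9 := ctx.theta_highest _ h6
  rw [h7] at h9
  have h10 : ctx.θ - (δ - (-2 : ℝ) • (ctx.θ - δ)) = -(ctx.θ - δ) := by module
  rw [h10] at h9
  exact neg_not_mem_cone_of_pos (pos_of_mem_cone h3 hc) h9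

theorem cartanPairing_theta_eq_one {γ : V} (hγ : γ ∈ ctx.Δ) (hne : γ ≠ ctx.θ)
    (h : 0 < ⟪γ, ctx.θ⟫) : cartanPairing γ ctx.θ = 1 := by
  have h1 := one_le_cartanPairing hγ theta_mem_root h
  have h2 : ¬ 2 ≤ cartanPairing γ ctx.θ := fun h2 => hne (eq_theta_of_two_le hγ h2)
  obtain ⟨k, hk⟩ := ctx.pairing_int _ theta_mem_root γ hγ
  rw [hk] at h1 h2 ⊢
  have h3 : 1 ≤ k := by exact_mod_cast h1
  have h4 : ¬ 2 ≤ k := by exact_mod_cast h2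
  exact_mod_cast (by omega : k = 1)

theorem inner_pos_of_cartanPairing_eq_one {γ δ : V} (hδ : δ ∈ ctx.Δ)
    (h : cartanPairing γ δ = 1) : 0 < ⟪γ, δ⟫ :=
  (cartanPairing_pos_iff (ne_zero_of_mem hδ)).mp (h ▸ one_pos)

theorem pos_of_cartanPairing_theta_eq_one {γ : V} (hγ : γ ∈ ctx.Δ)
    (h : cartanPairing γ ctx.θ = 1) : γ ∈ ctx.Pos := by
  have h1 := inner_pos_of_cartanPairing_eq_one theta_mem_root h
  by_contra hn
  have h2 := inner_theta_nonneg_of_pos (neg_pos_of_not_pos hγ hn)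
  rw [inner_neg_left] at h2
  linarith

theorem theta_sub_mem {γ : V} (hγ : γ ∈ ctx.Δ) (h : cartanPairing γ ctx.θ = 1) :
    ctx.θ - γ ∈ ctx.Δ ∧ cartanPairing (ctx.θ - γ) ctx.θ = 1 := by
  constructor
  · have := ctx.neg_mem _ (ctx.reflect_mem _ theta_mem_root γ hγ)
    rwa [h, one_smul, neg_sub] at this
  · rw [cartanPairing_sub, h, cartanPairing_self theta_ne_zero]
    norm_num

section UniqueAdjacent

variable {α : V}

theorem exists_eq_smul_add (huniq : ∀ β ∈ ctx.base, ⟪ctx.θ, β⟫ ≠ 0 → β = α) {m : V}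
    (hm : m ∈ ctx.cone) :
    ∃ k : ℕ, ∃ m' ∈ ctx.cone, ⟪m', ctx.θ⟫ = 0 ∧ m = (k : ℝ) • α + m' := by
  induction hm using AddSubmonoid.closure_induction with
  | mem x hx =>
    by_cases h : ⟪ctx.θ, x⟫ = 0
    · exact ⟨0, x, AddSubmonoid.subset_closure hx, by rwa [real_inner_comm], by simp⟩
    · exact ⟨1, 0, zero_mem _, by simp, by simp [huniq x hx h]⟩
  | zero => exact ⟨0, 0, zero_mem _, by simp, by simp⟩
  | add x y _ _ hx hy =>
    obtain ⟨k, m, hm, h, rfl⟩ := hx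
    obtain ⟨k', m', hm', h', rfl⟩ := hy
    refine ⟨k + k', m + m', add_mem hm hm', by rw [inner_add_left, h, h', add_zero], ?_⟩
    push_cast
    module

theorem IsCascade.twiceProj_sub_mem_cone (hK : ctx.IsCascade K) {m : V} (hm : m ∈ ctx.cone) :
    twiceProj K m - m ∈ ctx.cone := by
  induction hm using AddSubmonoid.closure_induction with
  | mem x hx => exact mem_cone_of_pos (hK.neg_reflect_pos (ctx.base_subset hx))
  | zero => simp [twiceProj, cartanPairing]
  | add x y _ _ hx hy =>
    rw [twiceProj_add, add_sub_add_comm]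
    exact add_mem hx hy

theorem IsCascade.twiceProj_twiceProj (hK : ctx.IsCascade K) (v : V) :
    twiceProj K (twiceProj K v) = (2 : ℝ) • twiceProj K v := by
  conv_lhs => rw [twiceProj]
  conv_rhs => rw [twiceProj, Finset.smul_sum]
  refine Finset.sum_congr rfl fun β hβ => ?_
  rw [smul_smul]
  congr 1
  have h := inner_twiceProj_of_mem hK.pairwise hβ v
  unfold cartanPairing at h ⊢
  rw [h]
  ring

/-- The simple root adjacent to `θ` lies in the span of the cascade. -/
theorem IsCascade.twiceProj_eq_two_smul (hK : ctx.IsCascade K) (hα : α ∈ ctx.base)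
    (hne : ⟪ctx.θ, α⟫ ≠ 0) (huniq : ∀ β ∈ ctx.base, ⟪ctx.θ, β⟫ ≠ 0 → β = α) :
    twiceProj K α = (2 : ℝ) • α := by
  rw [real_inner_comm] at hne
  have h1 := mem_cone_of_pos (hK.neg_reflect_pos (ctx.base_subset hα))
  obtain ⟨k, m, hm, h0, h⟩ := exists_eq_smul_add huniq h1
  have h2 : ⟪twiceProj K α - α, ctx.θ⟫ = ⟪α, ctx.θ⟫ := by
    rw [inner_sub_left, inner_twiceProj_of_mem hK.pairwise hK.theta_mem]
    ring
  rw [h, inner_add_left, h0, real_inner_smul_left, add_zero] at h2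
  rw [mul_left_eq_self₀.mp h2 |>.resolve_right hne, one_smul] at h
  have h3 : twiceProj K α = (2 : ℝ) • α + m := by
    rw [sub_eq_iff_eq_add] at h
    rw [h]
    module
  have h4 := hK.twiceProj_twiceProj α
  rw [h3, twiceProj_add, two_smul, twiceProj_add, h3] at h4
  have h5 : m = 0 := by
    refine eq_zero_of_add_eq_zero hm (hK.twiceProj_sub_mem_cone hm) ?_
    rw [← sub_eq_zero] at h4
    rw [← h4]
    module
  rw [h3, h5, add_zero]

theorem IsCascade.corootWeight_adjacent (hK : ctx.IsCascade K) (hα : α ∈ ctx.base)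
    (hfund : cartanPairing ctx.θ α = 1) (huniq : ∀ β ∈ ctx.base, ⟪ctx.θ, β⟫ ≠ 0 → β = α) :
    corootWeight K α = -2 := by
  have hαΔ := base_mem_root hα
  have hα0 := ne_zero_of_mem hαΔ
  have hpos : 0 < ⟪ctx.θ, α⟫ := inner_pos_of_cartanPairing_eq_one hαΔ hfund
  have hpos' : 0 < ⟪α, ctx.θ⟫ := by rwa [real_inner_comm]
  have hαθ : α ≠ ctx.θ := fun h => by
    rw [← h, cartanPairing_self hα0] at hfund
    norm_num at hfund
  have h1 : cartanPairing α ctx.θ = 1 := cartanPairing_theta_eq_one hαΔ hαθ hpos'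
  have hsum : ∑ β ∈ K, cartanPairing α β * cartanPairing β α = 4 := by
    have h2 := two_mul_inner_twiceProj K α
    rw [hK.twiceProj_eq_two_smul hα hpos.ne' huniq, real_inner_smul_left] at h2
    exact mul_right_cancel₀ (inner_self_pos_of_mem hαΔ).ne' (by linarith)
  have hterm : ∀ β ∈ K.erase ctx.θ,
      cartanPairing α β * cartanPairing β α = -cartanPairing α β := by
    intro β hβ
    have hβK := Finset.mem_of_mem_erase hβ
    have hβΔ := hK.mem_root hβK
    have hβθ := hK.inner_theta_of_mem_erase hβ
    have hβp : cartanPairing β ctx.θ = 0 := (cartanPairing_eq_zero_iff theta_ne_zero).mpr hβθ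
    have hle : ⟪α, β⟫ ≤ 0 := by
      by_contra! h
      rcases sub_mem_or_eq hαΔ hβΔ h with h2 | h2
      · have h3 := pos_of_cartanPairing_theta_eq_one h2 (by
          rw [cartanPairing_sub, h1, hβp, sub_zero])
        obtain ⟨k, m, hm, h0, h⟩ := exists_eq_smul_add huniq (mem_cone_of_pos h3)
        have h4 : (k : ℝ) = 1 := by
          have h5 : ⟪α - β, ctx.θ⟫ = ⟪α, ctx.θ⟫ := by rw [inner_sub_left, hβθ, sub_zero]
          rw [h, inner_add_left, h0, real_inner_smul_left, add_zero] at h5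
          exact mul_left_eq_self₀.mp h5 |>.resolve_right hpos'.ne'
        rw [h4, one_smul, sub_eq_add_neg, add_left_cancel_iff] at h
        exact neg_not_mem_cone_of_pos (hK.pos_of_mem hβK) (h ▸ hm)
      · rw [h2, hβθ] at hpos'
        exact hpos'.false
    rcases hle.lt_or_eq with hlt | h0
    · have h2 : 1 ≤ -cartanPairing β α := by
        rw [← cartanPairing_neg]
        refine one_le_cartanPairing (ctx.neg_mem β hβΔ) hαΔ ?_
        rw [inner_neg_left, real_inner_comm]
        linarith
      have h3 : ¬ 2 ≤ -cartanPairing β α := by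
        intro h3
        have h4 := ctx.reflect_mem α hαΔ β hβΔ
        have h5 := eq_theta_of_two_le h4 (by
          rw [cartanPairing_sub, cartanPairing_smul, h1, hβp]
          linarith)
        have h6 : cartanPairing (β - cartanPairing β α • α) α = 1 := by rw [h5, hfund]
        have h7 : cartanPairing (β - cartanPairing β α • α) ctx.θ = 2 := by
          rw [h5, cartanPairing_self theta_ne_zero]
        rw [cartanPairing_sub, cartanPairing_smul] at h6 h7
        rw [cartanPairing_self hα0] at h6
        rw [h1, hβp] at h7
        linarith
      have h4 : cartanPairing β α = -1 := by
        obtain ⟨k, hk⟩ := ctx.pairing_int α hαΔ β hβΔ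
        rw [hk] at h2 h3 ⊢
        have h2' : 1 ≤ -k := by exact_mod_cast h2
        have h3' : ¬ 2 ≤ -k := by exact_mod_cast h3
        exact_mod_cast (by omega : k = -1)
      rw [h4]; ring
    · rw [(cartanPairing_eq_zero_iff (ne_zero_of_mem hβΔ)).mpr h0]; ring
  rw [← Finset.add_sum_erase K _ hK.theta_mem, h1, hfund, Finset.sum_congr rfl hterm,
    Finset.sum_neg_distrib] at hsum
  rw [hK.corootWeight_eq, h1, corootWeight]
  linarith

end UniqueAdjacent

theorem exists_coordinates {α α' : V} (hα : α ∈ ctx.base) (hα' : α' ∈ ctx.base) (hne : α ≠ α')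
    (h : ⟪ctx.θ, α⟫ ≠ 0) (h' : ⟪ctx.θ, α'⟫ ≠ 0) :
    ∃ f f' : V →ₗ[ℝ] ℝ, f ctx.θ = 1 ∧ f' ctx.θ = 1 ∧
      ∀ m ∈ ctx.cone, ∃ n n' : ℕ, f m = n ∧ f' m = n' ∧ (n + n' : ℝ) ≤ cartanPairing m ctx.θ := by
  have hadj {a : V} (ha : a ∈ ctx.base) (h0 : ⟪ctx.θ, a⟫ ≠ 0) : 1 ≤ cartanPairing a ctx.θ := by
    rw [real_inner_comm] at h0
    exact one_le_cartanPairing (base_mem_root ha) theta_mem_root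
      ((inner_theta_nonneg_of_pos (ctx.base_subset ha)).lt_of_ne' h0)
  obtain ⟨f, hf⟩ := ctx.exists_linearMap_base fun a => if a = α then 1 else 0
  obtain ⟨f', hf'⟩ := ctx.exists_linearMap_base fun a => if a = α' then 1 else 0
  have key : ∀ m ∈ ctx.cone, ∃ n n' : ℕ, f m = n ∧ f' m = n' ∧
      (n + n' : ℝ) ≤ cartanPairing m ctx.θ := by
    intro m hm
    induction hm using AddSubmonoid.closure_induction with
    | mem x hx =>
      by_cases hxα : x = α
      · subst hxα
        exact ⟨1, 0, by simp [hf x hx], by simp [hf' x hx, hne], by simpa using hadj hx h⟩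
      by_cases hxα' : x = α'
      · subst hxα'
        exact ⟨0, 1, by simp [hf x hx, hxα], by simp [hf' x hx], by simpa using hadj hx h'⟩
      exact ⟨0, 0, by simp [hf x hx, hxα], by simp [hf' x hx, hxα'], by
        simpa using (cartanPairing_nonneg_iff theta_ne_zero).mpr
          (inner_theta_nonneg_of_pos (ctx.base_subset hx))⟩
    | zero => exact ⟨0, 0, by simp, by simp, by simp [cartanPairing]⟩
    | add x y _ _ hx hy =>
      obtain ⟨n, n', h1, h2, h3⟩ := hx
      obtain ⟨k, k', h4, h5, h6⟩ := hy
      refine ⟨n + k, n' + k', by simp [h1, h4], by simp [h2, h5], ?_⟩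
      rw [cartanPairing_add]
      push_cast
      linarith
  obtain ⟨n, n', hn, hn', hle⟩ := key _ (mem_cone_of_pos ctx.theta_mem)
  obtain ⟨k, -, hk, -⟩ := key _ (ctx.theta_highest α (base_mem_root hα))
  obtain ⟨-, k', -, hk', -⟩ := key _ (ctx.theta_highest α' (base_mem_root hα'))
  rw [map_sub, hn, hf α hα, if_pos rfl] at hk
  rw [map_sub, hn', hf' α' hα', if_pos rfl] at hk'
  rw [cartanPairing_self theta_ne_zero] at hle
  have h1 : n = k + 1 := by exact_mod_cast sub_eq_iff_eq_add.mp hk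
  have h2 : n' = k' + 1 := by exact_mod_cast sub_eq_iff_eq_add.mp hk'
  have h3 : n + n' ≤ 2 := by exact_mod_cast hle
  refine ⟨f, f', ?_, ?_, key⟩
  · rw [hn]; exact_mod_cast (by omega : n = 1)
  · rw [hn']; exact_mod_cast (by omega : n' = 1)

section TwoCoordinates

variable {f f' : V →ₗ[ℝ] ℝ}

theorem inner_pos_of_coordinate_eq_one (hθ : f ctx.θ = 1) (hθ' : f' ctx.θ = 1)
    (hcone : ∀ m ∈ ctx.cone, ∃ n n' : ℕ, f m = n ∧ f' m = n' ∧
      (n + n' : ℝ) ≤ cartanPairing m ctx.θ)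
    {γ γ' : V} (hγ : γ ∈ ctx.Δ) (hγ1 : cartanPairing γ ctx.θ = 1) (hγ' : γ' ∈ ctx.Δ)
    (hγ'1 : cartanPairing γ' ctx.θ = 1) (hf : f γ = 1) (hf0 : f' γ = 0) (hf' : f γ' = 1)
    (hf'0 : f' γ' = 0) : 0 < ⟪γ, γ'⟫ := by
  by_contra! hle
  have h1 := inner_pos_of_cartanPairing_eq_one theta_mem_root hγ'1
  rw [real_inner_comm] at h1
  rcases sub_mem_or_eq (theta_sub_mem hγ hγ1).1 hγ' (by rw [inner_sub_left]; linarith) with h | h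
  · have h2 : f (ctx.θ - γ - γ') = -1 := by rw [map_sub, map_sub, hθ, hf, hf']; norm_num
    have h3 : f' (ctx.θ - γ - γ') = 1 := by rw [map_sub, map_sub, hθ', hf0, hf'0]; norm_num
    rcases ctx.pos_or_neg _ h with h4 | h4
    · obtain ⟨n, -, hn, -⟩ := hcone _ (mem_cone_of_pos h4)
      rw [h2] at hn
      linarith [n.cast_nonneg (α := ℝ)]
    · obtain ⟨-, n, -, hn, -⟩ := hcone _ (mem_cone_of_pos h4)
      rw [map_neg, h3] at hn
      linarith [n.cast_nonneg (α := ℝ)]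
  · have h2 := congrArg f h
    rw [map_sub, hθ, hf, hf'] at h2
    norm_num at h2

theorem IsCascade.corootWeight_erase_le_one_of_coordinates (hK : ctx.IsCascade K)
    (hθ : f ctx.θ = 1) (hθ' : f' ctx.θ = 1)
    (hcone : ∀ m ∈ ctx.cone, ∃ n n' : ℕ, f m = n ∧ f' m = n' ∧
      (n + n' : ℝ) ≤ cartanPairing m ctx.θ)
    {γ : V} (hγ : γ ∈ ctx.Δ) (hγ1 : cartanPairing γ ctx.θ = 1) (hf : f γ = 1) (hf0 : f' γ = 0) :
    corootWeight (K.erase ctx.θ) γ ≤ 1 := by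
  have hzero : ∀ β ∈ K.erase ctx.θ, f β = 0 ∧ f' β = 0 := by
    intro β hβ
    obtain ⟨n, n', hn, hn', hle⟩ :=
      hcone β (mem_cone_of_pos (hK.pos_of_mem (Finset.mem_of_mem_erase hβ)))
    rw [(cartanPairing_eq_zero_iff theta_ne_zero).mpr (hK.inner_theta_of_mem_erase hβ)] at hle
    have h1 : n + n' ≤ 0 := by exact_mod_cast hle
    rw [hn, hn']
    exact ⟨by exact_mod_cast (by omega : n = 0), by exact_mod_cast (by omega : n' = 0)⟩
  have hmem : γ - twiceProj (K.erase ctx.θ) γ ∈ ctx.Δ :=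
    sub_twiceProj_mem hK.pairwise_erase hγ fun β hβ _ u hu =>
      ctx.reflect_mem β (hK.erase_subset_root hβ) u hu
  have hmap : ∀ φ : V →ₗ[ℝ] ℝ, (∀ β ∈ K.erase ctx.θ, φ β = 0) →
      φ (γ - twiceProj (K.erase ctx.θ) γ) = φ γ := fun φ hφ => by
    rw [map_sub, twiceProj, map_sum, Finset.sum_eq_zero fun β hβ => by simp [hφ β hβ], sub_zero]
  have h1 : cartanPairing (γ - twiceProj (K.erase ctx.θ) γ) ctx.θ = 1 := by
    rw [cartanPairing_sub, hγ1, (cartanPairing_eq_zero_iff theta_ne_zero).mpr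
      (inner_twiceProj_of_orthogonal γ fun β => hK.inner_theta_of_mem_erase), sub_zero]
  have h2 := inner_pos_of_coordinate_eq_one hθ hθ' hcone hγ hγ1 hmem h1 hf hf0
    (by rw [hmap f fun β hβ => (hzero β hβ).1, hf])
    (by rw [hmap f' fun β hβ => (hzero β hβ).2, hf0])
  rw [inner_sub_right, real_inner_comm] at h2
  have h3 := two_mul_inner_twiceProj (K.erase ctx.θ) γ
  have h4 := corootWeight_le_sum hK.erase_subset_root hγ
  have h5 := inner_self_pos_of_mem hγ
  rw [real_inner_comm] at h3
  obtain ⟨k, hk⟩ := exists_int_corootWeight hK.erase_subset_root hγ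
  have h6 : corootWeight (K.erase ctx.θ) γ < 2 := by
    refine h4.trans_lt ?_
    by_contra! h
    nlinarith
  rw [hk] at h6 ⊢
  have : k < 2 := by exact_mod_cast h6
  exact_mod_cast (by omega : k ≤ 1)

end TwoCoordinates

theorem IsCascade.corootWeight_erase_le_one_of_two_adjacent (hK : ctx.IsCascade K) {α α' : V}
    (hα : α ∈ ctx.base) (hα' : α' ∈ ctx.base) (hne : α ≠ α') (h : ⟪ctx.θ, α⟫ ≠ 0)
    (h' : ⟪ctx.θ, α'⟫ ≠ 0) {γ : V} (hγ : γ ∈ ctx.Δ) (hγ1 : cartanPairing γ ctx.θ = 1) :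
    corootWeight (K.erase ctx.θ) γ ≤ 1 := by
  obtain ⟨f, f', hθ, hθ', hcone⟩ := exists_coordinates hα hα' hne h h'
  obtain ⟨n, n', hn, hn', hle⟩ :=
    hcone γ (mem_cone_of_pos (pos_of_cartanPairing_theta_eq_one hγ hγ1))
  obtain ⟨h2, h3⟩ := theta_sub_mem hγ hγ1
  obtain ⟨k, k', hk, hk', hle'⟩ :=
    hcone _ (mem_cone_of_pos (pos_of_cartanPairing_theta_eq_one h2 h3))
  rw [hγ1] at hle
  rw [h3] at hle'
  rw [map_sub, hθ, hn] at hk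
  rw [map_sub, hθ', hn'] at hk'
  have e1 : k + n = 1 := by exact_mod_cast (by linarith : (k + n : ℝ) = 1)
  have e2 : k' + n' = 1 := by exact_mod_cast (by linarith : (k' + n' : ℝ) = 1)
  have e3 : n + n' ≤ 1 := by exact_mod_cast hle
  have e4 : k + k' ≤ 1 := by exact_mod_cast hle'
  rcases (by omega : (n = 1 ∧ n' = 0) ∨ (n' = 1 ∧ n = 0)) with ⟨rfl, rfl⟩ | ⟨rfl, rfl⟩
  · exact hK.corootWeight_erase_le_one_of_coordinates hθ hθ' hcone hγ hγ1
      (by exact_mod_cast hn) (by exact_mod_cast hn')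
  · refine hK.corootWeight_erase_le_one_of_coordinates hθ' hθ (fun m hm => ?_) hγ hγ1
      (by exact_mod_cast hn') (by exact_mod_cast hn)
    obtain ⟨a, b, ha, hb, hab⟩ := hcone m hm
    exact ⟨b, a, hb, ha, by linarith⟩

section LongAdjacentPairing

variable {α : V}

theorem not_inner_pos_of_inner_self_eq (hα : α ∈ ctx.base) (hge : 2 ≤ cartanPairing ctx.θ α)
    (huniq : ∀ β ∈ ctx.base, ⟪ctx.θ, β⟫ ≠ 0 → β = α) {γ : V} (hγ : γ ∈ ctx.Δ)
    (hγ1 : cartanPairing γ ctx.θ = 1) (hlong : ⟪γ, γ⟫ = ⟪ctx.θ, ctx.θ⟫) : ¬ 0 < ⟪γ, α⟫ := by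
  intro hpos
  have hαΔ := base_mem_root hα
  have hα2 := inner_self_pos_of_mem hαΔ
  have hθα : 0 < ⟪ctx.θ, α⟫ := (cartanPairing_pos_iff (ne_zero_of_mem hαΔ)).mp (by linarith)
  obtain ⟨k, m, hm, hm0, hkm⟩ :=
    exists_eq_smul_add huniq (mem_cone_of_pos (pos_of_cartanPairing_theta_eq_one hγ hγ1))
  have hm0' := (cartanPairing_eq_zero_iff theta_ne_zero).mpr hm0
  have h1 : 1 ≤ cartanPairing α ctx.θ :=
    one_le_cartanPairing hαΔ theta_mem_root (by rwa [real_inner_comm])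
  have h2 : (k : ℝ) * cartanPairing α ctx.θ = 1 := by
    rw [← hγ1, hkm, cartanPairing_add, cartanPairing_smul, hm0', add_zero]
  have hk : k = 1 := by
    have hk0 : k ≠ 0 := by rintro rfl; norm_num at h2
    have hk1 : (k : ℝ) ≤ 1 := by nlinarith [k.cast_nonneg (α := ℝ)]
    have : k ≤ 1 := by exact_mod_cast hk1
    omega
  rw [hk, Nat.cast_one, one_mul] at h2
  rw [hk, Nat.cast_one, one_smul] at hkm
  have e1 := two_mul_inner α ctx.θ
  have e2 := two_mul_inner ctx.θ α
  have e3 := two_mul_inner γ α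
  have e4 := two_mul_inner α γ
  have e5 := one_le_cartanPairing hαΔ hγ (by rwa [real_inner_comm])
  rw [h2, one_mul, real_inner_comm, e2] at e1
  rw [real_inner_comm, e3, hlong, ← e1] at e4
  have hθge : 2 * ⟪α, α⟫ ≤ cartanPairing ctx.θ α * ⟪α, α⟫ :=
    mul_le_mul_of_nonneg_right hge hα2.le
  have hn : 2 ≤ cartanPairing γ α := by
    refine le_of_mul_le_mul_right ?_ hα2
    nlinarith
  have h3 := ctx.reflect_mem α hαΔ γ hγ
  have h4 : γ - cartanPairing γ α • α ∉ ctx.Pos := fun h => by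
    have := (cartanPairing_nonneg_iff theta_ne_zero).mpr (inner_theta_nonneg_of_pos h)
    rw [cartanPairing_sub, cartanPairing_smul, hγ1, h2] at this
    linarith
  obtain ⟨k', m', hm', hm'0, hkm'⟩ :=
    exists_eq_smul_add huniq (mem_cone_of_pos (neg_pos_of_not_pos h3 h4))
  have h5 : (k' : ℝ) = cartanPairing γ α - 1 := by
    have := congrArg (cartanPairing · ctx.θ) hkm'
    simp only [cartanPairing_neg, cartanPairing_sub, cartanPairing_smul, cartanPairing_add, hγ1, h2,
      (cartanPairing_eq_zero_iff theta_ne_zero).mpr hm'0] at this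
    linarith
  have h6 : m + m' = 0 := by
    rw [h5] at hkm'
    have h7 : m' = -(γ - cartanPairing γ α • α) - (cartanPairing γ α - 1) • α := by
      rw [hkm']; module
    have h8 : m = γ - α := by rw [hkm]; module
    rw [h7, h8]
    module
  rw [eq_zero_of_add_eq_zero hm hm' h6, add_zero] at hkm
  rw [hkm] at hlong
  linarith

theorem two_le_cartanPairing_theta (hα : α ∈ ctx.base) (hge : 2 ≤ cartanPairing ctx.θ α)
    (huniq : ∀ β ∈ ctx.base, ⟪ctx.θ, β⟫ ≠ 0 → β = α) {γ : V} (hγ : γ ∈ ctx.Δ)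
    (hγ1 : cartanPairing γ ctx.θ = 1) : 2 ≤ cartanPairing ctx.θ γ := by
  by_contra! hlt
  have hγθ := inner_pos_of_cartanPairing_eq_one theta_mem_root hγ1
  rw [real_inner_comm] at hγθ
  have h1 := one_le_cartanPairing theta_mem_root hγ hγθ
  have h2 : cartanPairing ctx.θ γ = 1 := by
    obtain ⟨k, hk⟩ := ctx.pairing_int γ hγ _ theta_mem_root
    rw [hk] at h1 hlt ⊢
    have h1' : 1 ≤ k := by exact_mod_cast h1
    have h2' : k < 2 := by exact_mod_cast hlt
    exact_mod_cast (by omega : k = 1)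
  have e1 := two_mul_inner γ ctx.θ
  have e2 := two_mul_inner ctx.θ γ
  rw [hγ1, one_mul, real_inner_comm] at e1
  rw [h2, one_mul] at e2
  obtain ⟨h3, h4⟩ := theta_sub_mem hγ hγ1
  have h5 := not_inner_pos_of_inner_self_eq hα hge huniq hγ hγ1 (by rw [← e1, ← e2])
  have h6 := not_inner_pos_of_inner_self_eq hα hge huniq h3 h4 (by
    rw [inner_sub_sub_self, real_inner_comm ctx.θ γ]
    linarith)
  have h7 : 0 < ⟪ctx.θ, α⟫ :=
    (cartanPairing_pos_iff (ne_zero_of_mem (base_mem_root hα))).mp (by linarith)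
  rw [inner_sub_left] at h6
  linarith

theorem exists_twiceProj_eq_add {Q : Finset V} {v : V}
    (hnat : ∀ β ∈ Q, ∃ k : ℕ, cartanPairing v β = k) (h : corootWeight Q v = 2) :
    ∃ a ∈ Q, ∃ b ∈ Q, twiceProj Q v = a + b := by
  choose! n hn using hnat
  let M : Multiset V := ∑ β ∈ Q, Multiset.replicate (n β) β
  have hcard : M.card = 2 := by
    have h1 : ((∑ β ∈ Q, n β : ℕ) : ℝ) = 2 := by
      rw [← h, corootWeight, Finset.sum_congr rfl hn, Nat.cast_sum]
    simp only [M, Multiset.card_sum, Multiset.card_replicate]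
    exact_mod_cast h1
  have hsum : M.sum = twiceProj Q v := by
    rw [twiceProj, Finset.sum_congr rfl fun β hβ => by rw [hn β hβ, Nat.cast_smul_eq_nsmul]]
    simp only [M, Multiset.sum_sum, Multiset.sum_replicate]
  have hmem : ∀ x ∈ M, x ∈ Q := fun x hx => by
    obtain ⟨β, hβ, hx⟩ := Multiset.mem_sum.mp hx
    rwa [Multiset.eq_of_mem_replicate hx]
  obtain ⟨a, b, hab⟩ := Multiset.card_eq_two.mp hcard
  refine ⟨a, hmem a (by simp [hab]), b, hmem b (by simp [hab]), ?_⟩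
  rw [← hsum, hab]
  simp

theorem cartanPairing_mul_nonneg (v w : V) : 0 ≤ cartanPairing v w * cartanPairing w v := by
  rw [cartanPairing, cartanPairing, real_inner_comm, div_mul_div_comm]
  exact div_nonneg (mul_self_nonneg _)
    (mul_nonneg real_inner_self_nonneg real_inner_self_nonneg)

theorem IsCascade.corootWeight_erase_le_one_of_unique_adjacent (hK : ctx.IsCascade K)
    (hred : ∀ γ ∈ ctx.Δ, γ + γ ∉ ctx.Δ) (hα : α ∈ ctx.base) (hge : 2 ≤ cartanPairing ctx.θ α)
    (huniq : ∀ β ∈ ctx.base, ⟪ctx.θ, β⟫ ≠ 0 → β = α) {γ : V} (hγ : γ ∈ ctx.Δ)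
    (hγ1 : cartanPairing γ ctx.θ = 1) : corootWeight (K.erase ctx.θ) γ ≤ 1 := by
  have hsub := hK.erase_subset_root
  have h1 := two_le_cartanPairing_theta hα hge huniq hγ hγ1
  have h2 := sum_cartanPairing_mul_le_four hK.pairwise (ne_zero_of_mem hγ)
  have hsum := Finset.add_sum_erase K (fun β => cartanPairing γ β * cartanPairing β γ) hK.theta_mem
  simp only [hγ1, one_mul] at hsum
  have h3 := corootWeight_le_sum hsub hγ
  obtain ⟨k, hk⟩ := exists_int_corootWeight hsub hγ
  by_contra! hlt
  have hge2 : 2 ≤ corootWeight (K.erase ctx.θ) γ := by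
    rw [hk] at hlt ⊢
    have : 1 < k := by exact_mod_cast hlt
    exact_mod_cast (by omega : 2 ≤ k)
  have hθγ : cartanPairing ctx.θ γ = 2 := by linarith
  have hcw : corootWeight (K.erase ctx.θ) γ = 2 := by linarith
  have hterm := (Finset.sum_eq_sum_iff_of_le fun β hβ => cartanPairing_le_mul (hsub hβ) hγ).mp
    (show corootWeight (K.erase ctx.θ) γ = _ by linarith)
  obtain ⟨a, ha, b, hb, hab⟩ := exists_twiceProj_eq_add (fun β hβ => by
    obtain ⟨j, hj⟩ := ctx.pairing_int β (hsub hβ) γ hγ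
    have h4 : 0 ≤ cartanPairing γ β := by
      rw [hterm β hβ]
      exact cartanPairing_mul_nonneg γ β
    rw [hj] at h4 ⊢
    have h5 : 0 ≤ j := by exact_mod_cast h4
    exact ⟨j.toNat, by exact_mod_cast (Int.toNat_of_nonneg h5).symm⟩) hcw
  have h4 := two_smul_eq_twiceProj hK.pairwise (v := γ) (by linarith)
  have h5 : twiceProj K γ = ctx.θ + twiceProj (K.erase ctx.θ) γ := by
    rw [twiceProj, ← Finset.add_sum_erase K _ hK.theta_mem, hγ1, one_smul, twiceProj]
  have h6 := ctx.neg_mem _ (ctx.reflect_mem γ hγ _ theta_mem_root)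
  rw [hθγ, h4, h5, neg_sub, add_sub_cancel_left, hab] at h6
  by_cases hne : a = b
  · rw [← hne] at h6
    exact hred a (hsub ha) h6
  · exact (hK.inner_eq_zero_and_add_notMem (Finset.mem_of_mem_erase ha)
      (Finset.mem_of_mem_erase hb) hne).2 h6

end LongAdjacentPairing

theorem exists_base_inner_theta_ne_zero : ∃ α ∈ ctx.base, ⟪ctx.θ, α⟫ ≠ 0 := by
  by_contra! h
  have h1 : ∀ m ∈ ctx.cone, ⟪ctx.θ, m⟫ = 0 := fun m hm => by
    induction hm using AddSubmonoid.closure_induction with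
    | mem x hx => exact h x hx
    | zero => simp
    | add x y _ _ hx hy => rw [inner_add_right, hx, hy, add_zero]
  exact (inner_self_pos_of_mem (theta_mem_root (ctx := ctx))).ne'
    (h1 _ (mem_cone_of_pos ctx.theta_mem))

theorem IsCascade.corootWeight_erase_le_one (hK : ctx.IsCascade K)
    (hred : ∀ γ ∈ ctx.Δ, γ + γ ∉ ctx.Δ) (hfund : ¬ ctx.ThetaFundamental) {γ : V} (hγ : γ ∈ ctx.Δ)
    (hγ1 : cartanPairing γ ctx.θ = 1) : corootWeight (K.erase ctx.θ) γ ≤ 1 := by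
  obtain ⟨α, hα, hne⟩ := exists_base_inner_theta_ne_zero (ctx := ctx)
  by_cases huniq : ∀ β ∈ ctx.base, ⟪ctx.θ, β⟫ ≠ 0 → β = α
  · refine hK.corootWeight_erase_le_one_of_unique_adjacent hred hα ?_ huniq hγ hγ1
    have hαΔ := base_mem_root hα
    have hpos : 0 < ⟪ctx.θ, α⟫ := by
      have := inner_theta_nonneg_of_pos (ctx.base_subset hα)
      rw [real_inner_comm] at this
      exact this.lt_of_ne' hne
    have h1 := one_le_cartanPairing theta_mem_root hαΔ hpos
    have h2 : cartanPairing ctx.θ α ≠ 1 := fun h => hfund ⟨α, hα, h, fun β hβ hβα =>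
      (cartanPairing_eq_zero_iff (ne_zero_of_mem (base_mem_root hβ))).mpr
        (not_not.mp fun h0 => hβα (huniq β hβ h0))⟩
    obtain ⟨k, hk⟩ := ctx.pairing_int α hαΔ _ theta_mem_root
    rw [hk] at h1 h2 ⊢
    have h1' : 1 ≤ k := by exact_mod_cast h1
    have h2' : k ≠ 1 := by exact_mod_cast h2
    exact_mod_cast (by omega : 2 ≤ k)
  · push Not at huniq
    obtain ⟨β, hβ, hβ0, hβα⟩ := huniq
    exact hK.corootWeight_erase_le_one_of_two_adjacent hβ hα hβα hβ0 hne hγ hγ1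

theorem IsCascade.corootWeight_le_two (hK : ctx.IsCascade K)
    (hred : ∀ γ ∈ ctx.Δ, γ + γ ∉ ctx.Δ) (hfund : ¬ ctx.ThetaFundamental) {γ : V}
    (hγ : γ ∈ ctx.Δ) : corootWeight K γ ≤ 2 := by
  have hle {δ : V} (hδ : δ ∈ ctx.Δ) (h1 : cartanPairing δ ctx.θ = 1) :=
    hK.corootWeight_erase_le_one hred hfund hδ h1
  rw [hK.corootWeight_eq]
  rcases lt_trichotomy ⟪γ, ctx.θ⟫ 0 with hlt | h0 | hgt
  · have hpos : 0 < ⟪-γ, ctx.θ⟫ := by rw [inner_neg_left]; linarith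
    by_cases hne : -γ = ctx.θ
    · rw [neg_eq_iff_eq_neg.mp hne, cartanPairing_neg, corootWeight_neg,
        hK.corootWeight_erase_theta, cartanPairing_self theta_ne_zero]
      norm_num
    · have h1 := cartanPairing_theta_eq_one (ctx.neg_mem γ hγ) hne hpos
      obtain ⟨h2, h3⟩ := theta_sub_mem (ctx.neg_mem γ hγ) h1
      have h4 := hle h2 h3
      rw [corootWeight_sub, corootWeight_neg, hK.corootWeight_erase_theta] at h4
      rw [cartanPairing_neg] at h1
      linarith
  · obtain ⟨ε, hε, hγε, hεθ⟩ := isLinked_root γ hγ ctx.θ theta_mem_root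
    rw [(cartanPairing_eq_zero_iff theta_ne_zero).mpr h0, zero_add]
    have key : ∀ ε ∈ ctx.Δ, ⟪γ, ε⟫ ≠ 0 → 0 < ⟪ε, ctx.θ⟫ →
        corootWeight (K.erase ctx.θ) γ ≤ 2 := by
      intro ε hε hγε hpos
      have hεne : ε ≠ ctx.θ := by rintro rfl; exact hγε h0
      have hε1 := cartanPairing_theta_eq_one hε hεne hpos
      have hγp := (cartanPairing_eq_zero_iff theta_ne_zero).mpr h0
      rcases hγε.lt_or_gt with h | h
      · rcases add_mem_or_eq_neg hγ hε h with h1 | h1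
        · have h2 := hle h1 (by rw [cartanPairing_add, hγp, hε1, zero_add])
          obtain ⟨h3, h4⟩ := theta_sub_mem hε hε1
          have h5 := hle h3 h4
          rw [corootWeight_add] at h2
          rw [corootWeight_sub, hK.corootWeight_erase_theta] at h5
          linarith
        · rw [h1, inner_neg_left] at h0
          linarith
      · rw [real_inner_comm] at h
        rcases sub_mem_or_eq hε hγ h with h1 | h1
        · obtain ⟨h3, h4⟩ := theta_sub_mem h1 (by rw [cartanPairing_sub, hγp, hε1, sub_zero])
          have h2 := hle hε hε1
          have h5 := hle h3 h4
          rw [corootWeight_sub, corootWeight_sub, hK.corootWeight_erase_theta] at h5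
          linarith
        · rw [h1] at hpos
          linarith
    rcases hεθ.lt_or_gt with h | h
    · exact key (-ε) (ctx.neg_mem ε hε) (by rwa [inner_neg_right, neg_ne_zero])
        (by rw [inner_neg_left]; linarith)
    · exact key ε hε hγε h
  · by_cases hne : γ = ctx.θ
    · rw [hne, hK.corootWeight_erase_theta, cartanPairing_self theta_ne_zero]
      norm_num
    · have h1 := cartanPairing_theta_eq_one hγ hne hgt
      have := hle hγ h1
      linarith

end Cascade

end RootSystemCtx

namespace LieRootData

variable {V : Type*} [NormedAddCommGroup V] [InnerProductSpace ℝ V] {ctx : RootSystemCtx V}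
  {g : Type*} [LieRing g] [LieAlgebra ℂ g] (d : LieRootData ctx g) {K : Finset V}

theorem add_self_notMem (d : LieRootData ctx g) {γ : V} (hγ : γ ∈ ctx.Δ) : γ + γ ∉ ctx.Δ := by
  intro h
  obtain ⟨c, hc, h1⟩ := d.bracket_e_e_root γ hγ γ hγ h
  rw [lie_self] at h1
  exact smul_ne_zero hc (d.e_ne _ h) h1.symm

/-- The span of the root vectors `e γ` whose weight with respect to `∑_{β ∈ K} β∨` is at least
`r`, together with the Cartan subalgebra (of weight `0`) when `r ≤ 0`. -/
def weightSpan (K : Finset V) (r : ℝ) : Submodule ℂ g :=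
  Submodule.span ℂ ({x | ∃ γ ∈ ctx.Δ, r ≤ corootWeight K γ ∧ x = d.e γ} ∪
    {x | r ≤ 0 ∧ ∃ v, x = d.coh v})

theorem e_mem_weightSpan {r : ℝ} {γ : V} (hγ : γ ∈ ctx.Δ) (h : r ≤ corootWeight K γ) :
    d.e γ ∈ d.weightSpan K r :=
  Submodule.subset_span (Or.inl ⟨γ, hγ, h, rfl⟩)

theorem coh_mem_weightSpan {r : ℝ} (h : r ≤ 0) (v : V) : d.coh v ∈ d.weightSpan K r :=
  Submodule.subset_span (Or.inr ⟨h, v, rfl⟩)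

theorem lie_sum_mem_weightSpan (hK : K ⊆ ctx.Δ) (hK2 : ∀ β ∈ K, corootWeight K β = 2) {r : ℝ}
    {x : g} (hx : x ∈ d.weightSpan K r) :
    ⁅∑ β ∈ K, d.e β, x⁆ ∈ d.weightSpan K (r + 2) := by
  induction hx using Submodule.span_induction with
  | mem x hx =>
    rw [sum_lie]
    refine sum_mem fun β hβ => ?_
    rcases hx with ⟨γ, hγ, hr, rfl⟩ | ⟨hr, v, rfl⟩
    · have hw : corootWeight K (β + γ) = 2 + corootWeight K γ := by
        rw [corootWeight_add, hK2 β hβ]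
      by_cases h : β + γ ∈ ctx.Δ
      · obtain ⟨c, -, hc⟩ := d.bracket_e_e_root β (hK hβ) γ hγ h
        rw [hc]
        exact Submodule.smul_mem _ _ (d.e_mem_weightSpan h (by linarith))
      by_cases h0 : β + γ = 0
      · rw [h0, corootWeight_zero] at hw
        obtain ⟨c, -, hc⟩ := d.bracket_e_e_neg β (hK hβ)
        rw [← neg_eq_of_add_eq_zero_right h0, hc]
        exact Submodule.smul_mem _ _ (d.coh_mem_weightSpan (by linarith) β)
      · rw [d.bracket_e_e_zero β (hK hβ) γ hγ h h0]
        exact zero_mem _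
    · rw [← lie_skew, d.bracket_coh_e v β (hK hβ)]
      exact neg_mem (Submodule.smul_mem _ _ (d.e_mem_weightSpan (hK hβ) (by linarith [hK2 β hβ])))
  | zero => simp
  | add x y _ _ hx hy => rw [lie_add]; exact add_mem hx hy
  | smul c x _ hx => rw [lie_smul]; exact Submodule.smul_mem _ _ hx

theorem ad_pow_mem_weightSpan (hK : K ⊆ ctx.Δ) (hK2 : ∀ β ∈ K, corootWeight K β = 2) {r : ℝ}
    {x : g} (hx : x ∈ d.weightSpan K r) (n : ℕ) :
    (LieAlgebra.ad ℂ g (∑ β ∈ K, d.e β) ^ n) x ∈ d.weightSpan K (r + 2 * n) := by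
  induction n with
  | zero => simpa using hx
  | succ n ih =>
    rw [pow_succ', Module.End.mul_apply, LieAlgebra.ad_apply]
    have := d.lie_sum_mem_weightSpan hK hK2 ih
    rwa [show r + 2 * ((n + 1 : ℕ) : ℝ) = r + 2 * n + 2 by push_cast; ring]

theorem weightSpan_eq_top {r : ℝ} (h0 : r ≤ 0) (hr : ∀ γ ∈ ctx.Δ, r ≤ corootWeight K γ) :
    d.weightSpan K r = ⊤ := by
  rw [eq_top_iff, d.span_top, d.t_span]
  refine sup_le (Submodule.span_le.mpr ?_) (Submodule.span_le.mpr ?_)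
  · rintro _ ⟨v, rfl⟩
    exact d.coh_mem_weightSpan h0 v
  · rintro _ ⟨γ, hγ, rfl⟩
    exact d.e_mem_weightSpan hγ (hr γ hγ)

theorem weightSpan_eq_bot {r : ℝ} (h0 : 0 < r) (hr : ∀ γ ∈ ctx.Δ, corootWeight K γ < r) :
    d.weightSpan K r = ⊥ := by
  rw [weightSpan, Submodule.span_eq_bot]
  rintro x (⟨γ, hγ, h, -⟩ | ⟨h, -⟩)
  · exact absurd (hr γ hγ) h.not_gt
  · exact absurd h h0.not_ge

theorem ad_sum_pow_eq_zero (hK : K ⊆ ctx.Δ) (hK2 : ∀ β ∈ K, corootWeight K β = 2) {n : ℕ}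
    (hn : ∀ γ ∈ ctx.Δ, corootWeight K γ ≤ n) :
    LieAlgebra.ad ℂ g (∑ β ∈ K, d.e β) ^ (n + 1) = 0 := by
  ext x
  have hn0 := n.cast_nonneg (α := ℝ)
  have hx : x ∈ d.weightSpan K (-n) := by
    rw [d.weightSpan_eq_top (by linarith) fun γ hγ => ?_]
    · exact Submodule.mem_top
    · have := hn _ (ctx.neg_mem γ hγ)
      rw [corootWeight_neg] at this
      linarith
  have h := d.ad_pow_mem_weightSpan hK hK2 hx (n + 1)
  rw [d.weightSpan_eq_bot (by push_cast; linarith) fun γ hγ => by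
    push_cast; linarith [hn γ hγ]] at h
  simpa using h

theorem coh_sum {ι : Type*} (s : Finset ι) (f : ι → V) :
    d.coh (∑ i ∈ s, f i) = ∑ i ∈ s, d.coh (f i) :=
  map_sum (AddMonoidHom.mk' d.coh d.coh_add) f s

theorem inner_sum_covec (K : Finset V) (γ : V) : ⟪γ, ∑ β ∈ K, covec β⟫ = corootWeight K γ := by
  rw [inner_sum, corootWeight]
  refine Finset.sum_congr rfl fun β _ => ?_
  rw [covec, real_inner_smul_right, cartanPairing]
  ring

theorem lie_coh_sum_covec (K : Finset V) {γ : V} (hγ : γ ∈ ctx.Δ) :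
    ⁅d.coh (∑ β ∈ K, covec β), d.e γ⁆ = (corootWeight K γ : ℂ) • d.e γ := by
  rw [d.bracket_coh_e _ γ hγ, inner_sum_covec]

/-- The sum of the root vectors of a strongly orthogonal set of roots is the nilpositive element
of an `sl₂`-triple whose neutral element is the sum of the coroots. -/
theorem exists_isSl2Triple (hK : K ⊆ ctx.Δ) (hne : K.Nonempty)
    (hK2 : ∀ β ∈ K, corootWeight K β = 2)
    (hsub : ∀ β ∈ K, ∀ β' ∈ K, β ≠ β' → β - β' ∉ ctx.Δ) :
    ∃ a : V → ℂ, IsSl2Triple (d.coh (∑ β ∈ K, covec β)) (∑ β ∈ K, d.e β)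
      (∑ β ∈ K, a β • d.e (-β)) := by
  have hscal : ∀ β ∈ K, ∃ a : ℂ, ⁅d.e β, a • d.e (-β)⁆ = d.coh (covec β) := fun β hβ => by
    obtain ⟨c, hc0, hc⟩ := d.bracket_e_e_neg β (hK hβ)
    refine ⟨((2 / ⟪β, β⟫ : ℝ) : ℂ) * c⁻¹, ?_⟩
    rw [lie_smul, hc, covec, d.coh_smul, smul_smul, mul_assoc, inv_mul_cancel₀ hc0, mul_one]
  choose! a ha using hscal
  refine ⟨a, ?_, ?_, ?_, ?_⟩
  · intro h0
    obtain ⟨β, hβ⟩ := hne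
    have h1 := d.lie_coh_sum_covec K (hK hβ)
    rw [h0, zero_lie, hK2 β hβ] at h1
    exact smul_ne_zero (by norm_num) (d.e_ne β (hK hβ)) h1.symm
  · rw [sum_lie_sum, coh_sum]
    refine Finset.sum_congr rfl fun β hβ => ?_
    rw [Finset.sum_eq_single_of_mem β hβ, ha β hβ]
    intro β' hβ' hne
    rw [lie_smul, d.bracket_e_e_zero β (hK hβ) (-β') (ctx.neg_mem _ (hK hβ')), smul_zero]
    · rw [← sub_eq_add_neg]
      exact hsub β hβ β' hβ' hne.symm
    · rw [← sub_eq_add_neg]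
      exact sub_ne_zero.mpr hne.symm
  · rw [lie_sum, Finset.smul_sum]
    refine Finset.sum_congr rfl fun β hβ => ?_
    rw [d.lie_coh_sum_covec K (hK hβ), hK2 β hβ, ← Nat.cast_smul_eq_nsmul ℂ]
    norm_num
  · rw [lie_sum, Finset.smul_sum, ← Finset.sum_neg_distrib]
    refine Finset.sum_congr rfl fun β hβ => ?_
    rw [lie_smul, d.lie_coh_sum_covec K (ctx.neg_mem β (hK hβ)), corootWeight_neg, hK2 β hβ,
      smul_comm, ← Nat.cast_smul_eq_nsmul ℂ, ← neg_smul]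
    norm_num

/-- A root vector of lowest weight `-n` is not killed by the `n`-th power of the nilpositive
element. -/
theorem ad_sum_pow_apply_ne_zero (hK : K ⊆ ctx.Δ) (hne : K.Nonempty)
    (hK2 : ∀ β ∈ K, corootWeight K β = 2)
    (hsub : ∀ β ∈ K, ∀ β' ∈ K, β ≠ β' → β - β' ∉ ctx.Δ) {γ : V} (hγ : γ ∈ ctx.Δ) {n : ℕ}
    (hγn : corootWeight K γ = -n) (hlow : ∀ δ ∈ ctx.Δ, -(n : ℝ) ≤ corootWeight K δ) :
    (LieAlgebra.ad ℂ g (∑ β ∈ K, d.e β) ^ n) (d.e γ) ≠ 0 := by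
  obtain ⟨a, ht⟩ := d.exists_isSl2Triple hK hne hK2 hsub
  have hP : ht.symm.HasPrimitiveVectorWith (d.e γ) (n : ℂ) :=
    { ne_zero := d.e_ne γ hγ
      lie_h := by
        rw [neg_lie, d.lie_coh_sum_covec K hγ, hγn]
        push_cast
        rw [neg_smul, neg_neg]
      lie_e := by
        rw [sum_lie]
        refine Finset.sum_eq_zero fun β hβ => ?_
        have hw : corootWeight K (-β + γ) = -2 - n := by
          rw [corootWeight_add, corootWeight_neg, hK2 β hβ, hγn, sub_eq_add_neg]
        rw [smul_lie, d.bracket_e_e_zero _ (ctx.neg_mem β (hK hβ)) γ hγ, smul_zero]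
        · intro h
          linarith [hlow _ h]
        · intro h
          rw [h, corootWeight_zero] at hw
          linarith [n.cast_nonneg (α := ℝ)] }
  exact hP.pow_toEnd_f_ne_zero_of_eq_nat rfl le_rfl

end LieRootData

/-- Height of the nilpotent element `e_K = Σ_{β ∈ K} e_β`: if `θ` is fundamental then
`(ad e_K)^4 (e_{-θ+α̃}) ≠ 0` and `(ad e_K)^5 = 0`; if `θ` is not fundamental then
`(ad e_K)^3 = 0` (and `(ad e_K)^2 ≠ 0`, so the height of `e_K` is `2`). -/
theorem cascade_nilpotent_height {V : Type*} [NormedAddCommGroup V] [InnerProductSpace ℝ V]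
    [FiniteDimensional ℝ V] (ctx : RootSystemCtx V)
    {g : Type*} [LieRing g] [LieAlgebra ℂ g] [FiniteDimensional ℂ g]
    (d : LieRootData ctx g)
    (K : Finset V) (hK : ctx.IsCascade K) :
    (∀ atil : V, ctx.ThetaFundamental → atil ∈ ctx.base → ⟪ctx.θ, atil⟫ ≠ 0 →
      (∀ β ∈ ctx.base, ⟪ctx.θ, β⟫ ≠ 0 → β = atil) →
      (LieAlgebra.ad ℂ g (∑ β ∈ K, d.e β) ^ 4) (d.e (atil - ctx.θ)) ≠ 0 ∧
      LieAlgebra.ad ℂ g (∑ β ∈ K, d.e β) ^ 5 = 0) ∧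
    (¬ ctx.ThetaFundamental →
      LieAlgebra.ad ℂ g (∑ β ∈ K, d.e β) ^ 3 = 0 ∧
      LieAlgebra.ad ℂ g (∑ β ∈ K, d.e β) ^ 2 ≠ 0) := by
  have hKΔ := hK.subset_root
  have hne : K.Nonempty := ⟨_, hK.theta_mem⟩
  have hK2 : ∀ β ∈ K, corootWeight K β = 2 := fun β hβ => hK.corootWeight_of_mem hβ
  have hsub : ∀ β ∈ K, ∀ β' ∈ K, β ≠ β' → β - β' ∉ ctx.Δ :=
    fun β hβ β' hβ' h => hK.sub_notMem hβ hβ' h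
  have hlow {n : ℕ} (h : ∀ γ ∈ ctx.Δ, corootWeight K γ ≤ n) :
      ∀ γ ∈ ctx.Δ, -(n : ℝ) ≤ corootWeight K γ := fun γ hγ => by
    have := h _ (ctx.neg_mem γ hγ)
    rw [corootWeight_neg] at this
    linarith
  have hθ := RootSystemCtx.theta_mem_root (ctx := ctx)
  refine ⟨fun α hfund hα hαθ huniq => ?_, fun hfund => ?_⟩
  · have hbound : ∀ γ ∈ ctx.Δ, corootWeight K γ ≤ (4 : ℕ) := fun γ hγ => by
      exact_mod_cast hK.corootWeight_le_four hγ
    refine ⟨?_, d.ad_sum_pow_eq_zero hKΔ hK2 hbound⟩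
    have hαΔ := RootSystemCtx.base_mem_root hα
    have hθα : cartanPairing ctx.θ α = 1 := by
      obtain ⟨α', hα', h1, h0⟩ := hfund
      by_cases h : α = α'
      · rwa [h]
      · exact absurd
          ((cartanPairing_eq_zero_iff (RootSystemCtx.ne_zero_of_mem hαΔ)).mp (h0 α hα h)) hαθ
    have hmem : α - ctx.θ ∈ ctx.Δ := by
      have := ctx.neg_mem _ (ctx.reflect_mem α hαΔ _ hθ)
      rwa [hθα, one_smul, neg_sub] at this
    refine d.ad_sum_pow_apply_ne_zero hKΔ hne hK2 hsub hmem ?_ (hlow hbound)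
    rw [corootWeight_sub, hK.corootWeight_adjacent hα hθα huniq, hK2 _ hK.theta_mem]
    norm_num
  · have hbound : ∀ γ ∈ ctx.Δ, corootWeight K γ ≤ (2 : ℕ) := fun γ hγ => by
      exact_mod_cast hK.corootWeight_le_two (fun γ hγ => d.add_self_notMem hγ) hfund hγ
    refine ⟨d.ad_sum_pow_eq_zero hKΔ hK2 hbound, fun h0 => ?_⟩
    refine d.ad_sum_pow_apply_ne_zero (n := 2) hKΔ hne hK2 hsub (ctx.neg_mem _ hθ) ?_
      (hlow hbound) (by rw [h0, LinearMap.zero_apply])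
    rw [corootWeight_neg, hK2 _ hK.theta_mem]
    norm_num
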